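/- There exists an absolute constant C > 0 such that for all natural numbers n and all integers m with n^{0.99} ≤ m ≤ n the following holds: if f(x) = ∑_{k=0}^{n} cos(kx) − ∑_{k=0}^{m} ε_k cos(kx), where ε_0, …, ε_m are independent random variables taking values 0 and 1 each with probability 1/2, then the expected number of zeros of f in [0, 2π] satisfies E Z(f) ≤ C·m. -/

import Mathlib

open Real MeasureTheory

/-- `zeros f S` : the number of zeros of `f` in the set `S`. -/
noncomputable def zeros (f : ℝ → ℝ) (S : Set ℝ) : ℕ := {x ∈ S | f x = 0}.ncard

/-- The Dirichlet-type kernel `D_n(x) = ∑_{k=0}^n cos (k x)`. -/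
noncomputable def Dker (n : ℕ) : ℝ → ℝ := fun x => ∑ k ∈ Finset.range (n + 1), Real.cos (k * x)

/-- The random polynomial `f ~ F_{n,m}` determined by the Bernoulli outcomes
`e : Fin (m+1) → Bool`:  `f(x) = ∑_{k=0}^n cos(kx) - ∑_{k=0}^m ε_k cos(kx)`. -/
noncomputable def F (n m : ℕ) (e : Fin (m + 1) → Bool) : ℝ → ℝ :=
  fun x => Dker n x - ∑ k : Fin (m + 1), (if e k then (1 : ℝ) else 0) * Real.cos ((k : ℕ) * x)


/-! ### Averages over independent fair bits -/

section Average

variable {ι : Type*} [Fintype ι]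

/-- The expectation of `φ` under independent fair bits indexed by `ι`. -/
noncomputable def bitAvg [DecidableEq ι] (φ : (ι → Bool) → ℝ) : ℝ :=
  (∑ e, φ e) / 2 ^ Fintype.card ι

/-- The probability of `s` under independent fair bits indexed by `ι`. -/
noncomputable def bitProb [DecidableEq ι] (s : Set (ι → Bool)) : ℝ :=
  bitAvg (s.indicator 1)

variable [DecidableEq ι]

lemma bitAvg_mono {φ ψ : (ι → Bool) → ℝ} (h : ∀ e, φ e ≤ ψ e) : bitAvg φ ≤ bitAvg ψ := by
  unfold bitAvg
  gcongr with e
  exact h e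

lemma bitAvg_add (φ ψ : (ι → Bool) → ℝ) :
    bitAvg (fun e => φ e + ψ e) = bitAvg φ + bitAvg ψ := by
  simp [bitAvg, Finset.sum_add_distrib, add_div]

lemma bitAvg_const_mul (c : ℝ) (φ : (ι → Bool) → ℝ) :
    bitAvg (fun e => c * φ e) = c * bitAvg φ := by
  simp [bitAvg, ← Finset.mul_sum, mul_div_assoc]

lemma bitAvg_sum {α : Type*} (s : Finset α) (φ : α → (ι → Bool) → ℝ) :
    bitAvg (fun e => ∑ a ∈ s, φ a e) = ∑ a ∈ s, bitAvg (φ a) := by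
  simp only [bitAvg, ← Finset.sum_div]
  rw [Finset.sum_comm]

lemma bitAvg_const (c : ℝ) : bitAvg (fun _ : ι → Bool => c) = c := by
  simp [bitAvg]

lemma bitProb_mono {s t : Set (ι → Bool)} (h : s ⊆ t) : bitProb s ≤ bitProb t :=
  bitAvg_mono fun e => Set.indicator_le_indicator_of_subset h (fun _ => zero_le_one) e

lemma bitProb_union_le (s t : Set (ι → Bool)) : bitProb (s ∪ t) ≤ bitProb s + bitProb t := by
  rw [bitProb, bitProb, bitProb, ← bitAvg_add]
  refine bitAvg_mono fun e => ?_
  by_cases hs : e ∈ s <;> by_cases ht : e ∈ t <;> simp [hs, ht]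

lemma bitProb_le_one (s : Set (ι → Bool)) : bitProb s ≤ 1 := by
  rw [← bitAvg_const (ι := ι) 1]
  refine bitAvg_mono fun e => ?_
  by_cases hs : e ∈ s <;> simp [hs]

/-- Resampling the bits outside `A` does not change an average. -/
lemma bitAvg_resample (A : Finset ι) (φ : (ι → Bool) → ℝ) :
    bitAvg (fun e => bitAvg fun e' => φ fun k => if k ∈ A then e k else e' k) = bitAvg φ := by
  let σ : ((ι → Bool) × (ι → Bool)) → ((ι → Bool) × (ι → Bool)) := fun p =>
    (fun k => if k ∈ A then p.1 k else p.2 k, fun k => if k ∈ A then p.2 k else p.1 k)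
  have hσ : Function.Involutive σ := by
    rintro ⟨e, e'⟩
    simp only [σ, Prod.mk.injEq]
    constructor <;> funext k <;> by_cases hk : k ∈ A <;> simp [hk]
  have h1 : ∑ p : (ι → Bool) × (ι → Bool), φ (σ p).1 = ∑ p : (ι → Bool) × (ι → Bool), φ p.1 :=
    Equiv.sum_comp hσ.toPerm (fun p => φ p.1)
  rw [Fintype.sum_prod_type, Fintype.sum_prod_type] at h1
  simp only [Finset.sum_const, Finset.card_univ, Fintype.card_fun, Fintype.card_bool,
    nsmul_eq_mul, ← Finset.mul_sum] at h1
  simp only [bitAvg, ← Finset.sum_div]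
  rw [h1]
  field_simp
  push_cast
  ring

/-- Second moment of a centred sum of fair bits. -/
lemma bitAvg_sq_sum (a : ι → ℝ) :
    bitAvg (fun e => (∑ k, (1 / 2 - (if e k then (1 : ℝ) else 0)) * a k) ^ 2) =
      (∑ k, a k ^ 2) / 4 := by
  have hoff : ∀ k l : ι, k ≠ l → bitAvg (fun e : ι → Bool =>
      (1 / 2 - (if e k then (1 : ℝ) else 0)) * a k *
        ((1 / 2 - (if e l then (1 : ℝ) else 0)) * a l)) = 0 := by
    intro k l hkl
    have hτ : Function.Involutive (fun e : ι → Bool => Function.update e k (!e k)) := by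
      intro e
      simp
    let τ : Equiv.Perm (ι → Bool) := hτ.toPerm
    have h := Equiv.sum_comp τ (fun e : ι → Bool =>
      (1 / 2 - (if e k then (1 : ℝ) else 0)) * a k *
        ((1 / 2 - (if e l then (1 : ℝ) else 0)) * a l))
    have h2 : ∑ e : ι → Bool, ((1 / 2 - (if (τ e) k then (1 : ℝ) else 0)) * a k *
        ((1 / 2 - (if (τ e) l then (1 : ℝ) else 0)) * a l)) =
        -∑ e : ι → Bool, ((1 / 2 - (if e k then (1 : ℝ) else 0)) * a k *
        ((1 / 2 - (if e l then (1 : ℝ) else 0)) * a l)) := by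
      rw [← Finset.sum_neg_distrib]
      refine Finset.sum_congr rfl fun e _ => ?_
      have e1 : (τ e) k = !e k := by simp [τ, Function.Involutive.toPerm]
      have e2 : (τ e) l = e l := by
        simp [τ, Function.Involutive.toPerm, Function.update_of_ne hkl.symm]
      rw [e1, e2]
      cases e k <;> simp <;> ring
    rw [h2] at h
    have h3 : ∑ e : ι → Bool, ((1 / 2 - (if e k then (1 : ℝ) else 0)) * a k *
        ((1 / 2 - (if e l then (1 : ℝ) else 0)) * a l)) = 0 := by linarith
    rw [bitAvg, h3, zero_div]
  have hdiag : ∀ k : ι, bitAvg (fun e : ι → Bool =>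
      (1 / 2 - (if e k then (1 : ℝ) else 0)) * a k *
        ((1 / 2 - (if e k then (1 : ℝ) else 0)) * a k)) = a k ^ 2 / 4 := by
    intro k
    rw [← bitAvg_const (ι := ι) (a k ^ 2 / 4)]
    congr 1
    funext e
    cases e k <;> simp <;> ring
  simp only [pow_two (∑ k, _), Finset.sum_mul_sum]
  rw [bitAvg_sum]
  simp_rw [bitAvg_sum]
  rw [Finset.sum_div]
  refine Finset.sum_congr rfl fun k _ => ?_
  rw [Finset.sum_eq_single k (fun l _ hl => hoff k l hl.symm) (by simp), hdiag]

end Average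

/-! ### Small ball estimates -/

section SmallBall

variable {ι : Type*} [Fintype ι] [DecidableEq ι]

lemma norm_one_add_exp_mul_I_le {θ : ℝ} (h : |θ| ≤ 1) :
    ‖1 + Complex.exp (θ * Complex.I)‖ ≤ 2 * Real.exp (-(θ ^ 2 / 20)) := by
  have h1 : 1 + Complex.exp (θ * Complex.I) =
      Complex.exp ((θ / 2 : ℝ) * Complex.I) * ((2 * Real.cos (θ / 2) : ℝ) : ℂ) := by
    push_cast
    rw [Complex.two_cos, mul_add, ← Complex.exp_add, ← Complex.exp_add]
    ring_nf
    simp [add_comm]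
  rw [h1, norm_mul, Complex.norm_exp_ofReal_mul_I, one_mul, Complex.norm_real, Real.norm_eq_abs,
    abs_mul, abs_two]
  have h3 := abs_le.mp h
  have hπ : |θ / 2| ≤ π := by
    rw [abs_div, abs_two]; linarith [Real.pi_gt_three]
  have hcos := Real.cos_le_one_sub_mul_cos_sq hπ
  have hpos : 0 ≤ Real.cos (θ / 2) := by
    apply Real.cos_nonneg_of_neg_pi_div_two_le_of_le <;> linarith [Real.pi_gt_three]
  rw [abs_of_nonneg hpos]
  have hπ2 : 1 / 5 ≤ 2 / π ^ 2 := by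
    rw [div_le_div_iff₀ (by norm_num) (by positivity)]
    nlinarith [Real.pi_lt_d2, Real.pi_pos]
  have := Real.add_one_le_exp (-(θ ^ 2 / 20))
  nlinarith [mul_le_mul_of_nonneg_right hπ2 (sq_nonneg (θ / 2))]

lemma sum_exp_neg_sq_sub_le (M : ℕ) :
    ∑ a : Fin M, ∑ b : Fin M, Real.exp (-(((a : ℝ) - b) ^ 2 / 20)) ≤ 50 * M := by
  set r : ℝ := Real.exp (-(1 / 20)) with hr
  have hr1 : r ≤ 20 / 21 := by
    rw [hr, Real.exp_neg]
    rw [inv_le_comm₀ (Real.exp_pos _) (by norm_num)]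
    have := Real.add_one_le_exp (1 / 20 : ℝ)
    norm_num at this ⊢
    linarith
  have hr0 : 0 ≤ r := (Real.exp_pos _).le
  have hgeom : ∀ N : ℕ, ∑ j ∈ Finset.range N, r ^ j ≤ 21 := by
    intro N
    have h := geom_sum_mul_neg r N
    have : 0 ≤ r ^ N := by positivity
    have hs : 0 ≤ ∑ j ∈ Finset.range N, r ^ j := Finset.sum_nonneg fun _ _ => by positivity
    nlinarith
  have hterm : ∀ d : ℕ, Real.exp (-((d : ℝ) ^ 2 / 20)) ≤ r ^ d := by
    intro d
    rw [hr, ← Real.exp_nat_mul]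
    apply Real.exp_le_exp.mpr
    have : (d : ℝ) ≤ (d : ℝ) ^ 2 := by exact_mod_cast Nat.le_self_pow two_ne_zero d
    linarith
  have hrow : ∀ a : Fin M, ∑ b : Fin M, Real.exp (-(((a : ℝ) - b) ^ 2 / 20)) ≤ 50 := by
    intro a
    have h1 : ∀ b : Fin M, Real.exp (-(((a : ℝ) - b) ^ 2 / 20)) ≤
        (if (b : ℕ) ≤ a then r ^ ((a : ℕ) - b) else 0) +
          (if (a : ℕ) ≤ b then r ^ ((b : ℕ) - a) else 0) := by
      intro b
      rcases le_total (b : ℕ) a with h | h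
      · have := hterm (a - b)
        rw [Nat.cast_sub h] at this
        rw [if_pos h]
        have : 0 ≤ (if (a : ℕ) ≤ b then r ^ ((b : ℕ) - a) else 0) := by split_ifs <;> positivity
        linarith
      · have := hterm (b - a)
        rw [Nat.cast_sub h] at this
        rw [if_pos h]
        have h4 : 0 ≤ (if (b : ℕ) ≤ a then r ^ ((a : ℕ) - b) else 0) := by
          split_ifs <;> positivity
        have h5 : ((a : ℝ) - b) ^ 2 = ((b : ℝ) - a) ^ 2 := by ring
        rw [h5]
        linarith
    have h2 : ∑ b : Fin M, (if (b : ℕ) ≤ a then r ^ ((a : ℕ) - b) else 0) ≤ 21 := by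
      rw [Fin.sum_univ_eq_sum_range (fun b => if b ≤ (a : ℕ) then r ^ ((a : ℕ) - b) else 0) M,
        ← Finset.sum_filter]
      have hsub : (Finset.range M).filter (fun b => b ≤ (a : ℕ)) ⊆ Finset.range (a + 1) := by
        intro b hb
        simp only [Finset.mem_filter, Finset.mem_range] at hb ⊢
        omega
      refine (Finset.sum_le_sum_of_subset_of_nonneg hsub fun _ _ _ => by positivity).trans ?_
      have := Finset.sum_range_reflect (fun j => r ^ j) ((a : ℕ) + 1)
      simp only [Nat.add_sub_cancel] at this
      rw [this]
      exact hgeom _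
    have h3 : ∑ b : Fin M, (if (a : ℕ) ≤ b then r ^ ((b : ℕ) - a) else 0) ≤ 21 := by
      rw [Fin.sum_univ_eq_sum_range (fun b => if (a : ℕ) ≤ b then r ^ (b - (a : ℕ)) else 0) M,
        ← Finset.sum_filter]
      have hsub : (Finset.range M).filter (fun b => (a : ℕ) ≤ b) ⊆ Finset.Ico (a : ℕ) (a + M) := by
        intro b hb
        simp only [Finset.mem_filter, Finset.mem_range, Finset.mem_Ico] at hb ⊢
        omega
      refine (Finset.sum_le_sum_of_subset_of_nonneg hsub fun _ _ _ => by positivity).trans ?_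
      rw [Finset.sum_Ico_eq_sum_range]
      simp only [Nat.add_sub_cancel_left]
      exact hgeom _
    calc _ ≤ ∑ b : Fin M, ((if (b : ℕ) ≤ a then r ^ ((a : ℕ) - b) else 0) +
          (if (a : ℕ) ≤ b then r ^ ((b : ℕ) - a) else 0)) := Finset.sum_le_sum fun b _ => h1 b
      _ ≤ 50 := by rw [Finset.sum_add_distrib]; linarith
  calc _ ≤ ∑ _a : Fin M, (50 : ℝ) := Finset.sum_le_sum fun a _ => hrow a
    _ = 50 * M := by simp [mul_comm]

lemma sum_exp_linear_bits (θ : ι → ℝ) :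
    ∑ e : ι → Bool, Complex.exp ((∑ k, (if e k then (1 : ℝ) else 0) * θ k : ℝ) * Complex.I) =
      ∏ k, (1 + Complex.exp (θ k * Complex.I)) := by
  have h : ∀ k, 1 + Complex.exp (θ k * Complex.I) =
      ∑ b : Bool, Complex.exp (((if b then (1 : ℝ) else 0) * θ k : ℝ) * Complex.I) := by
    intro k
    simp [add_comm]
  simp_rw [h]
  rw [Fintype.prod_sum]
  refine Finset.sum_congr rfl fun e _ => ?_
  rw [← Complex.exp_sum]
  push_cast
  rw [Finset.sum_mul]

/-- Small ball estimate on a box, with an explicit frequency grid of side `M`. -/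
lemma bitProb_smallBall_grid {d : ℕ} (v : ι → Fin d → ℝ) (b : Fin d → ℝ) {K R : ℝ} (hK : 0 < K)
    (hR : 1 ≤ R) (hv : ∀ k i, |v k i| ≤ 1)
    (hV : ∀ ξ : Fin d → ℝ, K ^ 2 * ∑ i, ξ i ^ 2 ≤ ∑ k, (∑ i, ξ i * v k i) ^ 2)
    (M : ℕ) (hM : 0 < M) (hMR : M * d * R ≤ K) :
    bitProb {e : ι → Bool | ∀ i, |∑ k, (if e k then (1 : ℝ) else 0) * v k i + b i| ≤ R} ≤
      4 * 50 ^ d / (M : ℝ) ^ d := by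
  set s : Set (ι → Bool) :=
    {e | ∀ i, |∑ k, (if e k then (1 : ℝ) else 0) * v k i + b i| ≤ R} with hs
  let S : (ι → Bool) → Fin d → ℝ := fun e i => ∑ k, (if e k then (1 : ℝ) else 0) * v k i + b i
  let ph : (Fin d → Fin M) → (ι → Bool) → ℝ := fun j e => K⁻¹ * ∑ i, (j i : ℝ) * S e i
  let W : (ι → Bool) → ℂ := fun e => ∑ j, Complex.exp (ph j e * Complex.I)
  have hM0 : (0 : ℝ) < M := by exact_mod_cast hM
  have hMd : (0 : ℝ) < (M : ℝ) ^ d := by positivity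
  have hlow : ∀ e ∈ s, ((M : ℝ) ^ d) ^ 2 / 4 ≤ ‖W e‖ ^ 2 := by
    intro e he
    have hph : ∀ j, |ph j e| ≤ 1 := by
      intro j
      have h1 : |∑ i, (j i : ℝ) * S e i| ≤ ∑ _i : Fin d, (M : ℝ) * R := by
        refine (Finset.abs_sum_le_sum_abs _ _).trans (Finset.sum_le_sum fun i _ => ?_)
        rw [abs_mul, Nat.abs_cast]
        have : ((j i : ℕ) : ℝ) ≤ M := by exact_mod_cast (j i).2.le
        gcongr
        exact he i
      simp only [Finset.sum_const, Finset.card_univ, Fintype.card_fin, nsmul_eq_mul] at h1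
      simp only [ph]
      rw [abs_mul, abs_of_pos (inv_pos.mpr hK), inv_mul_le_iff₀ hK]
      linarith
    have hre : (M : ℝ) ^ d / 2 ≤ (W e).re := by
      have h2 : (W e).re = ∑ j, Real.cos (ph j e) := by
        simp only [W, Complex.re_sum, Complex.exp_ofReal_mul_I_re]
      rw [h2]
      have h3 : ∑ _j : Fin d → Fin M, (1 / 2 : ℝ) ≤ ∑ j, Real.cos (ph j e) := by
        refine Finset.sum_le_sum fun j _ => ?_
        have h4 := Real.one_sub_sq_div_two_le_cos (x := ph j e)
        have h5 : (ph j e) ^ 2 ≤ 1 := by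
          rw [← sq_abs]; exact pow_le_one₀ (abs_nonneg _) (hph j)
        linarith
      simp only [Finset.sum_const, Finset.card_univ, Fintype.card_fun, Fintype.card_fin,
        nsmul_eq_mul] at h3
      push_cast at h3
      linarith
    have h6 : (M : ℝ) ^ d / 2 ≤ ‖W e‖ := hre.trans (Complex.re_le_norm _)
    calc ((M : ℝ) ^ d) ^ 2 / 4 = ((M : ℝ) ^ d / 2) ^ 2 := by ring
      _ ≤ _ := by gcongr
  have hpair : ∀ j j' : Fin d → Fin M,
      ‖∑ e : ι → Bool, Complex.exp ((ph j e - ph j' e : ℝ) * Complex.I)‖ ≤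
        2 ^ Fintype.card ι * ∏ i, Real.exp (-(((j i : ℝ) - j' i) ^ 2 / 20)) := by
    intro j j'
    let ξ : Fin d → ℝ := fun i => K⁻¹ * ((j i : ℝ) - j' i)
    let θ : ι → ℝ := fun k => ∑ i, ξ i * v k i
    have hphase : ∀ e : ι → Bool, ph j e - ph j' e =
        (∑ k, (if e k then (1 : ℝ) else 0) * θ k) + ∑ i, ξ i * b i := by
      intro e
      have h1 : ph j e - ph j' e = ∑ i, ξ i * S e i := by
        simp only [ph, ξ, ← mul_sub, ← Finset.sum_sub_distrib, Finset.mul_sum]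
        refine Finset.sum_congr rfl fun i _ => by ring
      rw [h1]
      simp only [S, mul_add, Finset.sum_add_distrib, θ, Finset.mul_sum]
      rw [Finset.sum_comm]
      congr 1
      refine Finset.sum_congr rfl fun i _ => Finset.sum_congr rfl fun k _ => by ring
    have hsum : ∑ e : ι → Bool, Complex.exp ((ph j e - ph j' e : ℝ) * Complex.I) =
        (∏ k, (1 + Complex.exp (θ k * Complex.I))) *
          Complex.exp ((∑ i, ξ i * b i : ℝ) * Complex.I) := by
      rw [← sum_exp_linear_bits, Finset.sum_mul]
      refine Finset.sum_congr rfl fun e _ => ?_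
      rw [hphase e, ← Complex.exp_add]
      push_cast
      ring_nf
    have hθ : ∀ k, |θ k| ≤ 1 := by
      intro k
      have h1 : |θ k| ≤ ∑ _i : Fin d, K⁻¹ * M := by
        refine (Finset.abs_sum_le_sum_abs _ _).trans (Finset.sum_le_sum fun i _ => ?_)
        simp only [ξ]
        rw [abs_mul, abs_mul, abs_of_pos (inv_pos.mpr hK)]
        have h2 : |((j i : ℕ) : ℝ) - (j' i : ℕ)| ≤ M := by
          have h3 : ((j i : ℕ) : ℝ) ≤ M := by exact_mod_cast (j i).2.le
          have h4 : ((j' i : ℕ) : ℝ) ≤ M := by exact_mod_cast (j' i).2.le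
          have h5 : (0 : ℝ) ≤ (j i : ℕ) := Nat.cast_nonneg _
          have h6 : (0 : ℝ) ≤ (j' i : ℕ) := Nat.cast_nonneg _
          rw [abs_le]; constructor <;> linarith
        calc _ ≤ K⁻¹ * M * 1 := by
              gcongr
              exact hv k i
          _ = _ := mul_one _
      simp only [Finset.sum_const, Finset.card_univ, Fintype.card_fin, nsmul_eq_mul] at h1
      refine h1.trans ?_
      rw [mul_left_comm, inv_mul_le_iff₀ hK]
      have : (d : ℝ) * M * 1 ≤ d * M * R := by gcongr
      linarith
    rw [hsum, norm_mul, Complex.norm_exp_ofReal_mul_I, mul_one, norm_prod]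
    calc ∏ k, ‖1 + Complex.exp (θ k * Complex.I)‖
        ≤ ∏ k, (2 * Real.exp (-(θ k ^ 2 / 20))) :=
          Finset.prod_le_prod (fun _ _ => norm_nonneg _) fun k _ =>
            norm_one_add_exp_mul_I_le (hθ k)
      _ = 2 ^ Fintype.card ι * Real.exp (-((∑ k, θ k ^ 2) / 20)) := by
          rw [Finset.prod_mul_distrib, ← Real.exp_sum, Finset.sum_neg_distrib, Finset.sum_div]
          simp
      _ ≤ 2 ^ Fintype.card ι * Real.exp (-((∑ i, ((j i : ℝ) - j' i) ^ 2) / 20)) := by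
          have h1 := hV ξ
          have h2 : K ^ 2 * ∑ i, ξ i ^ 2 = ∑ i, ((j i : ℝ) - j' i) ^ 2 := by
            simp only [ξ, mul_pow, ← Finset.mul_sum]
            field_simp
          rw [h2] at h1
          gcongr
      _ = _ := by
          rw [← Real.exp_sum, Finset.sum_neg_distrib, Finset.sum_div]
  have hup : ∑ e, ‖W e‖ ^ 2 ≤ 2 ^ Fintype.card ι * (50 * M) ^ d := by
    have h1 : ∀ e, ((‖W e‖ ^ 2 : ℝ) : ℂ) =
        ∑ j, ∑ j', Complex.exp ((ph j e - ph j' e : ℝ) * Complex.I) := by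
      intro e
      have h2 : ((‖W e‖ ^ 2 : ℝ) : ℂ) = W e * (starRingEnd ℂ) (W e) := by
        rw [Complex.mul_conj, Complex.normSq_eq_norm_sq]
      rw [h2]
      simp only [W, map_sum, Finset.sum_mul_sum]
      refine Finset.sum_congr rfl fun j _ => Finset.sum_congr rfl fun j' _ => ?_
      rw [← Complex.exp_conj, ← Complex.exp_add]
      simp only [map_mul, Complex.conj_ofReal, Complex.conj_I]
      push_cast
      ring_nf
    have h3 : ((∑ e, ‖W e‖ ^ 2 : ℝ) : ℂ) =
        ∑ j, ∑ j', ∑ e : ι → Bool, Complex.exp ((ph j e - ph j' e : ℝ) * Complex.I) := by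
      rw [Complex.ofReal_sum, Finset.sum_congr rfl fun e _ => h1 e, Finset.sum_comm]
      exact Finset.sum_congr rfl fun j _ => Finset.sum_comm
    have h4 : ∑ e, ‖W e‖ ^ 2 = ‖((∑ e, ‖W e‖ ^ 2 : ℝ) : ℂ)‖ := by
      rw [Complex.norm_real, Real.norm_of_nonneg (Finset.sum_nonneg fun _ _ => by positivity)]
    rw [h4, h3]
    calc _ ≤ ∑ j : Fin d → Fin M, ∑ j' : Fin d → Fin M,
          2 ^ Fintype.card ι * ∏ i, Real.exp (-(((j i : ℝ) - j' i) ^ 2 / 20)) :=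
          (norm_sum_le _ _).trans <| Finset.sum_le_sum fun j _ =>
            (norm_sum_le _ _).trans <| Finset.sum_le_sum fun j' _ => hpair j j'
      _ = 2 ^ Fintype.card ι * (∑ a : Fin M, ∑ b : Fin M,
            Real.exp (-(((a : ℝ) - b) ^ 2 / 20))) ^ d := by
          rw [Fintype.sum_pow]
          simp_rw [Fintype.prod_sum, ← Finset.mul_sum]
      _ ≤ _ := by
          gcongr
          exact sum_exp_neg_sq_sub_le M
  have hmain : bitProb s * (((M : ℝ) ^ d) ^ 2 / 4) ≤ (50 * M) ^ d := by
    rw [bitProb, mul_comm, ← bitAvg_const_mul, bitAvg, div_le_iff₀ (by positivity), mul_comm]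
    refine le_trans (Finset.sum_le_sum fun e _ => ?_) hup
    by_cases he : e ∈ s
    · simpa [he] using hlow e he
    · simp [he]
  rw [le_div_iff₀ hMd]
  have h7 : bitProb s * (M : ℝ) ^ d * ((M : ℝ) ^ d) ≤ 4 * 50 ^ d * (M : ℝ) ^ d := by
    rw [mul_pow] at hmain
    nlinarith
  exact le_of_mul_le_mul_right h7 hMd

/-- Small ball estimate: a box of side `R` is hit with probability `O_d((R / K) ^ d)`, where `K ^ 2`
is a lower bound for the covariance form. -/
lemma bitProb_smallBall {d : ℕ} (hd : 0 < d) (v : ι → Fin d → ℝ) (b : Fin d → ℝ) {K R : ℝ}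
    (hK : 0 < K) (hR : 1 ≤ R) (hv : ∀ k i, |v k i| ≤ 1)
    (hV : ∀ ξ : Fin d → ℝ, K ^ 2 * ∑ i, ξ i ^ 2 ≤ ∑ k, (∑ i, ξ i * v k i) ^ 2) :
    bitProb {e : ι → Bool | ∀ i, |∑ k, (if e k then (1 : ℝ) else 0) * v k i + b i| ≤ R} ≤
      4 * (100 * d) ^ d * (R / K) ^ d := by
  have hd1 : (1 : ℝ) ≤ d := by exact_mod_cast hd
  have hdR : (0 : ℝ) < d * R := by positivity
  rcases le_or_gt (d * R) K with h | h
  · set y : ℝ := K / (d * R) with hy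
    have hy1 : 1 ≤ y := by rwa [hy, one_le_div hdR]
    have hM : 0 < ⌊y⌋₊ := Nat.floor_pos.mpr hy1
    have hfl : (⌊y⌋₊ : ℝ) ≤ y := Nat.floor_le (by linarith)
    have hfl2 : y / 2 ≤ ⌊y⌋₊ := by
      have h1 := Nat.lt_floor_add_one y
      have h2 : (1 : ℝ) ≤ ⌊y⌋₊ := by exact_mod_cast hM
      linarith
    have hyR : y * (d * R) = K := by rw [hy]; field_simp
    refine (bitProb_smallBall_grid v b hK hR hv hV ⌊y⌋₊ hM ?_).trans ?_
    · rw [mul_assoc]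
      calc _ ≤ y * (d * R) := by gcongr
        _ = K := hyR
    · calc 4 * 50 ^ d / (⌊y⌋₊ : ℝ) ^ d ≤ 4 * 50 ^ d / (y / 2) ^ d := by gcongr
        _ = 4 * (100 * d) ^ d * (R / K) ^ d := by
          rw [hy, mul_assoc, ← mul_pow, mul_div_assoc, ← div_pow]
          congr 2
          field_simp
          ring
  · refine (bitProb_le_one _).trans ?_
    have h1 : 1 ≤ 100 * d * (R / K) := by
      rw [← mul_div_assoc, one_le_div hK]
      nlinarith
    have h2 := one_le_pow₀ h1 (n := d)
    rw [mul_pow] at h2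
    linarith

end SmallBall

/-! ### Summation by parts and quadratic forms of trigonometric vectors -/

section Trigonometric

lemma norm_one_sub_mul_norm_sum_mul_pow_le {a : ℕ → ℝ} (ha : Monotone a) (ha0 : 0 ≤ a 0) {z : ℂ}
    (hz : ‖z‖ = 1) (N : ℕ) :
    ‖1 - z‖ * ‖∑ k ∈ Finset.range (N + 1), (a k : ℂ) * z ^ k‖ ≤ 2 * a N := by
  have hpos : ∀ k, 0 ≤ a k := fun k => ha0.trans (ha (Nat.zero_le k))
  have key : ∀ N : ℕ, ‖(1 - z) * ∑ k ∈ Finset.range (N + 1), (a k : ℂ) * z ^ k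
      + a N * z ^ (N + 1)‖ ≤ a N := by
    intro N
    induction N with
    | zero =>
      have : (1 - z) * ∑ k ∈ Finset.range (0 + 1), (a k : ℂ) * z ^ k + a 0 * z ^ (0 + 1) = a 0 := by
        simp; ring
      rw [this, Complex.norm_real, Real.norm_of_nonneg ha0]
    | succ N ih =>
      rw [Finset.sum_range_succ]
      have : (1 - z) * (∑ k ∈ Finset.range (N + 1), (a k : ℂ) * z ^ k
          + (a (N + 1) : ℂ) * z ^ (N + 1)) + (a (N + 1) : ℂ) * z ^ (N + 1 + 1) =
          ((1 - z) * ∑ k ∈ Finset.range (N + 1), (a k : ℂ) * z ^ k + a N * z ^ (N + 1))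
          + ((a (N + 1) - a N : ℝ) : ℂ) * z ^ (N + 1) := by
        push_cast; ring
      rw [this]
      refine (norm_add_le _ _).trans ?_
      rw [norm_mul, norm_pow, hz, one_pow, mul_one, Complex.norm_real,
        Real.norm_of_nonneg (sub_nonneg.mpr (ha (Nat.le_succ N)))]
      linarith
  have h1 : (1 - z) * ∑ k ∈ Finset.range (N + 1), (a k : ℂ) * z ^ k =
      ((1 - z) * ∑ k ∈ Finset.range (N + 1), (a k : ℂ) * z ^ k + a N * z ^ (N + 1))
        - a N * z ^ (N + 1) := by ring
  rw [← norm_mul, h1]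
  refine (norm_sub_le _ _).trans ?_
  rw [norm_mul, norm_pow, hz, one_pow, mul_one, Complex.norm_real, Real.norm_of_nonneg (hpos N)]
  linarith [key N]

lemma abs_sin_half_mul_abs_sum_mul_cos_le {a : ℕ → ℝ} (ha : Monotone a) (ha0 : 0 ≤ a 0)
    (x φ : ℝ) (N : ℕ) :
    |Real.sin (x / 2)| * |∑ k ∈ Finset.range (N + 1), a k * Real.cos (k * x + φ)| ≤ a N := by
  set z : ℂ := Complex.exp (Complex.I * x) with hz
  have hz1 : ‖z‖ = 1 := by rw [hz, mul_comm]; exact Complex.norm_exp_ofReal_mul_I x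
  have h := norm_one_sub_mul_norm_sum_mul_pow_le ha ha0 hz1 N
  rw [norm_sub_rev, hz, Complex.norm_exp_I_mul_ofReal_sub_one, ← hz, norm_mul] at h
  have hre : ∑ k ∈ Finset.range (N + 1), a k * Real.cos (k * x + φ) =
      (Complex.exp (φ * Complex.I) * ∑ k ∈ Finset.range (N + 1), (a k : ℂ) * z ^ k).re := by
    rw [Finset.mul_sum, Complex.re_sum]
    refine Finset.sum_congr rfl fun k _ => ?_
    have : Complex.exp (φ * Complex.I) * ((a k : ℂ) * z ^ k) =
        (a k : ℂ) * Complex.exp ((k * x + φ : ℝ) * Complex.I) := by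
      rw [hz, ← Complex.exp_nat_mul, mul_left_comm, ← Complex.exp_add]
      push_cast
      ring_nf
    rw [this, Complex.re_ofReal_mul, Complex.exp_ofReal_mul_I_re]
  have hle : |∑ k ∈ Finset.range (N + 1), a k * Real.cos (k * x + φ)| ≤
      ‖∑ k ∈ Finset.range (N + 1), (a k : ℂ) * z ^ k‖ := by
    rw [hre]
    refine (Complex.abs_re_le_norm _).trans ?_
    rw [norm_mul, Complex.norm_exp_ofReal_mul_I, one_mul]
  have h2 : ‖(2 : ℝ)‖ = 2 := by norm_num
  rw [h2, Real.norm_eq_abs] at h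
  have := mul_le_mul_of_nonneg_left hle (abs_nonneg (Real.sin (x / 2)))
  linarith

lemma abs_sin_mul_abs_sum_mul_cos_two_le {a : ℕ → ℝ} (ha : Monotone a) (ha0 : 0 ≤ a 0)
    (x φ : ℝ) (N : ℕ) :
    |Real.sin x| * |∑ k ∈ Finset.range (N + 1), a k * Real.cos (2 * (k * x) + φ)| ≤ a N := by
  have h := abs_sin_half_mul_abs_sum_mul_cos_le ha ha0 (2 * x) φ N
  rw [mul_div_cancel_left₀ x two_ne_zero] at h
  simpa only [mul_left_comm _ (2 : ℝ) x] using h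

/-- The squares of `cos (k x)` have average bounded below, uniformly in `x`. -/
lemma le_sum_cos_sq (m : ℕ) (x : ℝ) :
    (m : ℝ) / 16 ≤ ∑ k ∈ Finset.range (m + 1), Real.cos (k * x) ^ 2 := by
  have h1 : ∀ k ∈ Finset.range (m / 2 + 1),
      (1 / 4 : ℝ) ≤ Real.cos (k * x) ^ 2 + Real.cos ((2 * k : ℕ) * x) ^ 2 := by
    intro k _
    have : ((2 * k : ℕ) : ℝ) * x = 2 * (k * x) := by push_cast; ring
    rw [this, Real.cos_two_mul]
    nlinarith [sq_nonneg (Real.cos (k * x) ^ 2 - 3 / 8)]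
  have h2 := Finset.sum_le_sum h1
  rw [Finset.sum_add_distrib] at h2
  have h3 : ∑ k ∈ Finset.range (m / 2 + 1), Real.cos (k * x) ^ 2 ≤
      ∑ k ∈ Finset.range (m + 1), Real.cos (k * x) ^ 2 := by
    refine Finset.sum_le_sum_of_subset_of_nonneg ?_ fun _ _ _ => sq_nonneg _
    intro k hk
    simp only [Finset.mem_range] at hk ⊢
    omega
  have h4 : ∑ k ∈ Finset.range (m / 2 + 1), Real.cos ((2 * k : ℕ) * x) ^ 2 ≤
      ∑ k ∈ Finset.range (m + 1), Real.cos (k * x) ^ 2 := by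
    rw [← Finset.sum_image (f := fun k : ℕ => Real.cos (k * x) ^ 2) (g := fun k => 2 * k)
      (s := Finset.range (m / 2 + 1)) (by intro a _ b _ h; simpa using h)]
    refine Finset.sum_le_sum_of_subset_of_nonneg ?_ fun _ _ _ => sq_nonneg _
    intro k hk
    simp only [Finset.mem_image, Finset.mem_range] at hk ⊢
    omega
  have h5 : (m : ℝ) / 2 ≤ ((m / 2 + 1 : ℕ) : ℝ) := by
    rw [div_le_iff₀ two_pos]
    exact_mod_cast (by omega : m ≤ (m / 2 + 1) * 2)
  simp only [Finset.sum_const, Finset.card_range, nsmul_eq_mul] at h2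
  linarith

lemma abs_sum_cos_sq_sub_le {x : ℝ} (hx : Real.sin x ≠ 0) (N : ℕ) :
    |∑ k ∈ Finset.range N, Real.cos (k * x) ^ 2 - N / 2| ≤ 1 / (2 * |Real.sin x|) := by
  have hs : 0 < |Real.sin x| := abs_pos.mpr hx
  have h1 : ∑ k ∈ Finset.range N, Real.cos (k * x) ^ 2 - N / 2 =
      (∑ k ∈ Finset.range N, Real.cos (2 * (k * x))) / 2 := by
    simp_rw [Real.cos_sq, Finset.sum_add_distrib, ← Finset.sum_div]
    simp
  rw [h1, abs_div, abs_two, div_le_iff₀ two_pos]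
  have h2 : 1 / (2 * |Real.sin x|) * 2 = 1 / |Real.sin x| := by field_simp
  rw [h2, le_div_iff₀' hs]
  cases N with
  | zero => simp
  | succ N =>
    simpa using abs_sin_mul_abs_sum_mul_cos_two_le (a := fun _ => 1) monotone_const zero_le_one x 0 N

lemma jet_form_pointwise {t : ℝ} (ht0 : 0 ≤ t) (ht : t ≤ 1 / 4) (a b c : ℝ) :
    (a ^ 2 + b ^ 2 + c ^ 2) / 16 ≤ ((a - c * t ^ 2) ^ 2 + b ^ 2 * t ^ 2) +
      ((a - c * (1 - t) ^ 2) ^ 2 + b ^ 2 * (1 - t) ^ 2) := by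
  set u := t ^ 2 with hu
  set w := (1 - t) ^ 2 with hw
  have hu0 : 0 ≤ u := sq_nonneg _
  have hu1 : u ≤ 1 / 16 := by nlinarith
  have hw1 : 9 / 16 ≤ w := by nlinarith
  have hb : b ^ 2 / 16 ≤ b ^ 2 * u + b ^ 2 * w := by nlinarith [sq_nonneg b]
  set A := a - c * u with hA
  set B := a - c * w with hB
  have hAB : A - B = c * (w - u) := by rw [hA, hB]; ring
  have h1 : c ^ 2 / 4 ≤ (A - B) ^ 2 := by
    rw [hAB, mul_pow]
    have : (1 / 4 : ℝ) ≤ (w - u) ^ 2 := by nlinarith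
    nlinarith [sq_nonneg c]
  have h2 : c ^ 2 ≤ 8 * (A ^ 2 + B ^ 2) := by nlinarith [sq_nonneg (A + B)]
  have h3 : a ^ 2 ≤ 2 * A ^ 2 + 2 * (c * u) ^ 2 := by
    have : a = A + c * u := by rw [hA]; ring
    rw [this]
    nlinarith [sq_nonneg (A - c * u)]
  have h4 : (c * u) ^ 2 ≤ c ^ 2 / 256 := by
    rw [mul_pow]
    have : u ^ 2 ≤ 1 / 256 := by nlinarith
    nlinarith [sq_nonneg c]
  nlinarith [sq_nonneg A, sq_nonneg B]

lemma le_sum_jet_form {m : ℕ} (hm : 0 < m) (a b c : ℝ) :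
    m / 128 * (a ^ 2 + b ^ 2 + c ^ 2) ≤ ∑ k ∈ Finset.range (m + 1),
      ((a - c * ((k : ℝ) / m) ^ 2) ^ 2 + b ^ 2 * ((k : ℝ) / m) ^ 2) := by
  set G : ℝ → ℝ := fun t => (a - c * t ^ 2) ^ 2 + b ^ 2 * t ^ 2 with hG
  have hG0 : ∀ t, 0 ≤ G t := fun t => by positivity
  have hm0 : (0 : ℝ) < m := by exact_mod_cast hm
  have hrefl : ∑ k ∈ Finset.range (m + 1), G (1 - (k : ℝ) / m) =
      ∑ k ∈ Finset.range (m + 1), G ((k : ℝ) / m) := by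
    rw [← Finset.sum_range_reflect]
    refine Finset.sum_congr rfl fun k hk => ?_
    have hk' : k ≤ m := by simpa [Nat.lt_succ_iff] using hk
    congr 1
    rw [Nat.add_sub_cancel, Nat.cast_sub hk']
    field_simp
    ring
  have h1 : ∑ _k ∈ Finset.range (m / 4 + 1), (a ^ 2 + b ^ 2 + c ^ 2) / 16 ≤
      ∑ k ∈ Finset.range (m + 1), (G ((k : ℝ) / m) + G (1 - (k : ℝ) / m)) := by
    have hsub : Finset.range (m / 4 + 1) ⊆ Finset.range (m + 1) := by
      intro k hk
      simp only [Finset.mem_range] at hk ⊢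
      omega
    refine le_trans (Finset.sum_le_sum fun k hk => ?_)
      (Finset.sum_le_sum_of_subset_of_nonneg hsub fun k _ _ => add_nonneg (hG0 _) (hG0 _))
    refine jet_form_pointwise (by positivity) ?_ a b c
    rw [div_le_iff₀ hm0]
    have : 4 * k ≤ m := by
      simp only [Finset.mem_range] at hk
      omega
    have : (4 : ℝ) * k ≤ m := by exact_mod_cast this
    linarith
  rw [Finset.sum_add_distrib, hrefl] at h1
  simp only [Finset.sum_const, Finset.card_range, nsmul_eq_mul] at h1
  have h5 : (m : ℝ) / 4 ≤ ((m / 4 + 1 : ℕ) : ℝ) := by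
    rw [div_le_iff₀ (by norm_num)]
    exact_mod_cast (by omega : m ≤ (m / 4 + 1) * 4)
  have h6 := mul_le_mul_of_nonneg_right h5
    (by positivity : 0 ≤ (a ^ 2 + b ^ 2 + c ^ 2) / 16)
  linarith

/-- Nondegeneracy of the covariance form of the (rescaled) `2`-jet of a random cosine
polynomial. -/
lemma le_sum_jet_sq {m : ℕ} (hm : 0 < m) {x : ℝ} (hx : 768 ≤ m * |Real.sin x|) (ξ : Fin 3 → ℝ) :
    m / 512 * ∑ i, ξ i ^ 2 ≤ ∑ k ∈ Finset.range (m + 1),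
      (∑ i : Fin 3, ξ i * (((k : ℝ) / m) ^ (i : ℕ) * Real.cos (k * x + (i : ℕ) * (π / 2)))) ^ 2 := by
  have hm0 : (0 : ℝ) < m := by exact_mod_cast hm
  have hs : 0 < |Real.sin x| := by
    by_contra h
    have : |Real.sin x| = 0 := le_antisymm (not_lt.mp h) (abs_nonneg _)
    rw [this] at hx
    norm_num at hx
  let D : ℕ → ℝ → ℝ := fun p φ =>
    ∑ k ∈ Finset.range (m + 1), ((k : ℝ) / m) ^ p * Real.cos (2 * (k * x) + φ)
  have hD : ∀ p φ, |D p φ| ≤ m / 768 := by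
    intro p φ
    have h := abs_sin_mul_abs_sum_mul_cos_two_le (a := fun k : ℕ => ((k : ℝ) / m) ^ p)
      (fun k l hkl => by
        have : (k : ℝ) ≤ l := by exact_mod_cast hkl
        change ((k : ℝ) / m) ^ p ≤ ((l : ℝ) / m) ^ p
        gcongr) (by positivity) x φ m
    simp only [div_self hm0.ne', one_pow] at h
    have h2 : |D p φ| ≤ 1 / |Real.sin x| := by rwa [le_div_iff₀' hs]
    refine h2.trans ?_
    rw [div_le_div_iff₀ hs (by norm_num)]
    linarith
  have hexp : ∑ k ∈ Finset.range (m + 1),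
      (∑ i : Fin 3, ξ i * (((k : ℝ) / m) ^ (i : ℕ) * Real.cos (k * x + (i : ℕ) * (π / 2)))) ^ 2 =
      (∑ k ∈ Finset.range (m + 1),
        ((ξ 0 - ξ 2 * ((k : ℝ) / m) ^ 2) ^ 2 + ξ 1 ^ 2 * ((k : ℝ) / m) ^ 2)) / 2 +
      (ξ 0 ^ 2 * D 0 0 + ξ 1 ^ 2 * D 2 π + ξ 2 ^ 2 * D 4 0 + 2 * (ξ 0 * ξ 1) * D 1 (π / 2)
        + 2 * (ξ 0 * ξ 2) * D 2 π + 2 * (ξ 1 * ξ 2) * D 3 (3 * π / 2)) / 2 := by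
    simp only [D, Finset.mul_sum, ← Finset.sum_add_distrib, Finset.sum_div]
    refine Finset.sum_congr rfl fun k _ => ?_
    have c1 : Real.cos (k * x + π / 2) = -Real.sin (k * x) := Real.cos_add_pi_div_two _
    have c2 : Real.cos (k * x + 2 * (π / 2)) = -Real.cos (k * x) := by
      rw [mul_div_cancel₀ π two_ne_zero, Real.cos_add_pi]
    have c3 : Real.cos (2 * (k * x) + π / 2) = -Real.sin (2 * (k * x)) :=
      Real.cos_add_pi_div_two _
    have c4 : Real.cos (2 * (k * x) + 3 * π / 2) = Real.sin (2 * (k * x)) := by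
      have : 2 * (k * x) + 3 * π / 2 = 2 * (k * x) + π / 2 + π := by ring
      rw [this, Real.cos_add_pi, c3, neg_neg]
    rw [Fin.sum_univ_three]
    simp only [Fin.val_zero, Fin.val_one, Fin.val_two, Nat.cast_zero, Nat.cast_one, Nat.cast_ofNat,
      zero_mul, one_mul, add_zero, Real.cos_add_pi, c1, c2, c3, c4, pow_zero, pow_one,
      Real.cos_two_mul, Real.sin_two_mul]
    have hsc := Real.sin_sq (k * x)
    ring_nf
    rw [hsc]
    ring
  have hmain := le_sum_jet_form hm (ξ 0) (ξ 1) (ξ 2)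
  have hE : ∀ (s : ℝ) (p : ℕ) (φ : ℝ), -(|s| * (m / 768)) ≤ s * D p φ := by
    intro s p φ
    have h := mul_le_mul_of_nonneg_left (hD p φ) (abs_nonneg s)
    rw [← abs_mul] at h
    linarith [neg_abs_le (s * D p φ)]
  have e1 := hE (ξ 0 ^ 2) 0 0
  have e2 := hE (ξ 1 ^ 2) 2 π
  have e3 := hE (ξ 2 ^ 2) 4 0
  have e4 := hE (2 * (ξ 0 * ξ 1)) 1 (π / 2)
  have e5 := hE (2 * (ξ 0 * ξ 2)) 2 π
  have e6 := hE (2 * (ξ 1 * ξ 2)) 3 (3 * π / 2)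
  have hq : |ξ 0 ^ 2| + |ξ 1 ^ 2| + |ξ 2 ^ 2| + |2 * (ξ 0 * ξ 1)| + |2 * (ξ 0 * ξ 2)|
      + |2 * (ξ 1 * ξ 2)| ≤ 3 * (ξ 0 ^ 2 + ξ 1 ^ 2 + ξ 2 ^ 2) := by
    simp only [abs_mul, abs_two, abs_pow, sq_abs]
    rw [← sq_abs (ξ 0), ← sq_abs (ξ 1), ← sq_abs (ξ 2)]
    nlinarith [sq_nonneg (|ξ 0| - |ξ 1|), sq_nonneg (|ξ 0| - |ξ 2|), sq_nonneg (|ξ 1| - |ξ 2|)]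
  have hq' := mul_le_mul_of_nonneg_right hq (by positivity : 0 ≤ (m : ℝ) / 768)
  rw [hexp, Fin.sum_univ_three]
  linarith

end Trigonometric

/-! ### Zeros and derivatives -/

section Zeros

/-- `f` has `r` distinct zeros in `s`. -/
def HasZeros (f : ℝ → ℝ) (s : Set ℝ) (r : ℕ) : Prop :=
  ∃ z : Fin r → ℝ, StrictMono z ∧ ∀ i, z i ∈ s ∧ f (z i) = 0

lemma hasZeros_of_le_ncard {f : ℝ → ℝ} {s : Set ℝ} {r : ℕ} (h : r ≤ {x ∈ s | f x = 0}.ncard) :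
    HasZeros f s r := by
  obtain ⟨t, hts, ht⟩ := Set.exists_subset_card_eq h
  rcases Nat.eq_zero_or_pos r with rfl | hr
  · exact ⟨fun i => i.elim0, fun i => i.elim0, fun i => i.elim0⟩
  have hfin : t.Finite := Set.finite_of_ncard_pos (by omega)
  have hcard : hfin.toFinset.card = r := by rw [← Set.ncard_eq_toFinset_card t hfin, ht]
  refine ⟨hfin.toFinset.orderEmbOfFin hcard, OrderEmbedding.strictMono _, fun i => ?_⟩
  have hmem := hfin.toFinset.orderEmbOfFin_mem hcard i
  exact hts (hfin.mem_toFinset.mp hmem)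

lemma HasZeros.deriv {f f' : ℝ → ℝ} (hf : ∀ x, HasDerivAt f (f' x) x) {a b : ℝ} {r : ℕ}
    (h : HasZeros f (Set.Icc a b) (r + 1)) : HasZeros f' (Set.Icc a b) r := by
  obtain ⟨z, hz, hz0⟩ := h
  have hex : ∀ i : Fin r, ∃ c ∈ Set.Ioo (z i.castSucc) (z i.succ), f' c = 0 := fun i =>
    exists_hasDerivAt_eq_zero (hz Fin.castSucc_lt_succ)
      (fun x _ => (hf x).continuousAt.continuousWithinAt)
      ((hz0 _).2.trans (hz0 _).2.symm) fun x _ => hf x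
  choose c hc hc0 using hex
  refine ⟨c, fun i j hij => ?_, fun i => ⟨⟨?_, ?_⟩, hc0 i⟩⟩
  · have : z i.succ ≤ z j.castSucc := hz.monotone
      (Fin.le_def.mpr (Nat.succ_le_of_lt (Fin.lt_def.mp hij)))
    exact (hc i).2.trans_le (this.trans (hc j).1.le)
  · exact (hz0 _).1.1.trans (hc i).1.le
  · exact (hc i).2.le.trans (hz0 _).1.2

lemma HasZeros.iterate {g : ℕ → ℝ → ℝ} (hg : ∀ j x, HasDerivAt (g j) (g (j + 1) x) x) {a b : ℝ}
    {r : ℕ} (h : HasZeros (g 0) (Set.Icc a b) r) {j : ℕ} (hj : j ≤ r) :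
    HasZeros (g j) (Set.Icc a b) (r - j) := by
  induction j with
  | zero => exact h
  | succ j ih =>
    refine HasZeros.deriv (hg j) ?_
    have : r - (j + 1) + 1 = r - j := by omega
    rw [this]
    exact ih (by omega)

lemma abs_sub_le_of_hasDerivAt {f f' : ℝ → ℝ} (hf : ∀ x, HasDerivAt f (f' x) x) {a ℓ B : ℝ}
    (hB : ∀ x ∈ Set.Icc a (a + ℓ), |f' x| ≤ B) (hB0 : 0 ≤ B) {x y : ℝ}
    (hx : x ∈ Set.Icc a (a + ℓ)) (hy : y ∈ Set.Icc a (a + ℓ)) : |f y - f x| ≤ ℓ * B := by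
  have h := Convex.norm_image_sub_le_of_norm_hasDerivWithin_le
    (fun x _ => (hf x).hasDerivWithinAt) hB (convex_Icc a (a + ℓ)) hx hy
  refine h.trans ?_
  rw [mul_comm]
  gcongr
  rw [Real.norm_eq_abs, abs_le]
  constructor <;> linarith [hx.1, hx.2, hy.1, hy.2]

/-- A function with many zeros in a short interval has small derivatives there. -/
lemma HasZeros.abs_le {g : ℕ → ℝ → ℝ} (hg : ∀ j x, HasDerivAt (g j) (g (j + 1) x) x) {a ℓ B : ℝ}
    (hℓ : 0 ≤ ℓ) (hB0 : 0 ≤ B) {r : ℕ} (h : HasZeros (g 0) (Set.Icc a (a + ℓ)) r)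
    (hB : ∀ x, |g r x| ≤ B) {s : ℕ} (hs : s ≤ r) :
    ∀ x ∈ Set.Icc a (a + ℓ), |g (r - s) x| ≤ ℓ ^ s * B := by
  induction s with
  | zero => intro x _; simpa using hB x
  | succ s ih =>
    intro x hx
    obtain ⟨z, -, hz⟩ := h.iterate hg (j := r - (s + 1)) (by omega)
    have hpos : 0 < r - (r - (s + 1)) := by omega
    obtain ⟨hzI, hz0⟩ := hz ⟨0, hpos⟩
    have he : r - (s + 1) + 1 = r - s := by omega
    have hd := hg (r - (s + 1))
    rw [he] at hd
    have h1 := abs_sub_le_of_hasDerivAt hd (ih (by omega)) (by positivity) hzI hx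
    rw [hz0, sub_zero] at h1
    rw [pow_succ', mul_assoc]
    exact h1

lemma HasZeros.abs_le_taylor {g : ℕ → ℝ → ℝ} (hg : ∀ j x, HasDerivAt (g j) (g (j + 1) x) x)
    {a ℓ B : ℝ} (hℓ : 0 ≤ ℓ) (hB0 : 0 ≤ B) (h : HasZeros (g 0) (Set.Icc a (a + ℓ)) 1)
    (hB : ∀ x, |g 4 x| ≤ B) :
    |g 0 a| ≤ ℓ * |g 1 a| + ℓ ^ 2 * |g 2 a| + ℓ ^ 3 * |g 3 a| + ℓ ^ 4 * B := by
  have ha : a ∈ Set.Icc a (a + ℓ) := ⟨le_rfl, by linarith⟩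
  have step : ∀ j C, 0 ≤ C → (∀ x ∈ Set.Icc a (a + ℓ), |g (j + 1) x| ≤ C) →
      ∀ x ∈ Set.Icc a (a + ℓ), |g j x| ≤ |g j a| + ℓ * C := by
    intro j C hC hb x hx
    have h1 := abs_sub_le_of_hasDerivAt (hg j) hb hC ha hx
    have h2 := abs_sub_abs_le_abs_sub (g j x) (g j a)
    linarith
  have h3 := step 3 B hB0 fun x _ => hB x
  have h2 := step 2 _ (by positivity) h3
  have h1 := step 1 _ (by positivity) h2
  obtain ⟨z, -, hz⟩ := h
  obtain ⟨hzI, hz0⟩ := hz 0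
  have h0 := abs_sub_le_of_hasDerivAt (hg 0) h1 (by positivity) hzI ha
  rw [hz0, sub_zero] at h0
  refine h0.trans (le_of_eq ?_)
  ring

/-- The `j`-th derivative of `F n m e`. -/
noncomputable def Fjet (n m : ℕ) (e : Fin (m + 1) → Bool) (j : ℕ) (x : ℝ) : ℝ :=
  ∑ k ∈ Finset.range (n + 1), (k : ℝ) ^ j * Real.cos (k * x + j * (π / 2)) -
    ∑ k : Fin (m + 1), (if e k then (1 : ℝ) else 0) *
      (((k : ℕ) : ℝ) ^ j * Real.cos ((k : ℕ) * x + j * (π / 2)))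

lemma Fjet_zero (n m : ℕ) (e : Fin (m + 1) → Bool) : Fjet n m e 0 = F n m e := by
  funext x
  simp [Fjet, F, Dker]

lemma hasDerivAt_Fjet (n m : ℕ) (e : Fin (m + 1) → Bool) (j : ℕ) (x : ℝ) :
    HasDerivAt (Fjet n m e j) (Fjet n m e (j + 1) x) x := by
  have h : ∀ k : ℕ, HasDerivAt (fun y : ℝ => (k : ℝ) ^ j * Real.cos (k * y + j * (π / 2)))
      ((k : ℝ) ^ (j + 1) * Real.cos (k * x + (j + 1 : ℕ) * (π / 2))) x := by
    intro k
    have h1 : HasDerivAt (fun y : ℝ => (k : ℝ) * y + j * (π / 2)) k x := by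
      simpa using ((hasDerivAt_id x).const_mul (k : ℝ)).add_const (j * (π / 2))
    refine ((h1.cos).const_mul ((k : ℝ) ^ j)).congr_deriv ?_
    have : (k : ℝ) * x + (j + 1 : ℕ) * (π / 2) = k * x + j * (π / 2) + π / 2 := by push_cast; ring
    rw [this, Real.cos_add_pi_div_two]
    ring
  unfold Fjet
  exact (HasDerivAt.fun_sum fun k _ => h k).sub
    (HasDerivAt.fun_sum fun k _ => (h k).const_mul _)

lemma abs_Fjet_le {n m : ℕ} (hmn : m ≤ n) (e : Fin (m + 1) → Bool) (j : ℕ) (x : ℝ) :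
    |Fjet n m e j x| ≤ 2 * (n + 1) * (n : ℝ) ^ j := by
  have h : ∀ k : ℕ, k ≤ n → |(k : ℝ) ^ j * Real.cos (k * x + j * (π / 2))| ≤ (n : ℝ) ^ j := by
    intro k hk
    rw [abs_mul, abs_pow, Nat.abs_cast]
    have : (k : ℝ) ≤ n := by exact_mod_cast hk
    calc (k : ℝ) ^ j * |Real.cos (k * x + j * (π / 2))| ≤ (n : ℝ) ^ j * 1 := by
          gcongr
          exact Real.abs_cos_le_one _
      _ = _ := mul_one _
  have h1 : |∑ k ∈ Finset.range (n + 1), (k : ℝ) ^ j * Real.cos (k * x + j * (π / 2))| ≤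
      (n + 1) * (n : ℝ) ^ j := by
    refine (Finset.abs_sum_le_sum_abs _ _).trans ?_
    refine (Finset.sum_le_sum fun k hk => h k ?_).trans ?_
    · simpa [Nat.lt_succ_iff] using hk
    · simp
  have h2 : |∑ k : Fin (m + 1), (if e k then (1 : ℝ) else 0) *
      (((k : ℕ) : ℝ) ^ j * Real.cos ((k : ℕ) * x + j * (π / 2)))| ≤ (n + 1) * (n : ℝ) ^ j := by
    refine (Finset.abs_sum_le_sum_abs _ _).trans ?_
    refine (Finset.sum_le_sum (g := fun _ => (n : ℝ) ^ j) fun k _ => ?_).trans ?_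
    · split_ifs
      · simpa using h k (by have := k.2; omega)
      · simp
    · simp only [Finset.sum_const, Finset.card_univ, Fintype.card_fin, nsmul_eq_mul]
      push_cast
      gcongr
  have := abs_sub (∑ k ∈ Finset.range (n + 1), (k : ℝ) ^ j * Real.cos (k * x + j * (π / 2)))
    (∑ k : Fin (m + 1), (if e k then (1 : ℝ) else 0) *
      (((k : ℕ) : ℝ) ^ j * Real.cos ((k : ℕ) * x + j * (π / 2))))
  unfold Fjet
  linarith

lemma zeros_F_Icc_pi_le {n m : ℕ} (hmn : m ≤ n) (e : Fin (m + 1) → Bool) :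
    zeros (F n m e) (Set.Icc 0 π) ≤ n := by
  set P : Polynomial ℝ := ∑ k ∈ Finset.range (n + 1), Polynomial.Chebyshev.T ℝ k -
    ∑ k : Fin (m + 1), Polynomial.C (if e k then (1 : ℝ) else 0) *
      Polynomial.Chebyshev.T ℝ (k : ℕ) with hP
  have heval : ∀ x, P.eval (Real.cos x) = F n m e x := by
    intro x
    simp only [hP, F, Dker, Polynomial.eval_sub, Polynomial.eval_finsetSum, Polynomial.eval_mul,
      Polynomial.eval_C, Polynomial.Chebyshev.T_real_cos, Int.cast_natCast]
  have hdeg : P.natDegree ≤ n := by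
    refine (Polynomial.natDegree_sub_le _ _).trans (max_le ?_ ?_)
    · refine Polynomial.natDegree_sum_le_of_forall_le _ _ fun k hk => ?_
      rw [Polynomial.Chebyshev.natDegree_T]
      simpa [Nat.lt_succ_iff] using hk
    · refine Polynomial.natDegree_sum_le_of_forall_le _ _ fun k _ => ?_
      refine (Polynomial.natDegree_C_mul_le _ _).trans ?_
      rw [Polynomial.Chebyshev.natDegree_T]
      have := k.2
      simp
      omega
  by_cases h0 : P = 0
  · have : {x ∈ Set.Icc 0 π | F n m e x = 0} = Set.Icc 0 π := by
      ext x
      simp [← heval, h0]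
    rw [zeros, this, (Set.Icc_infinite Real.pi_pos).ncard]
    exact Nat.zero_le _
  · have hinj : Set.InjOn Real.cos {x ∈ Set.Icc 0 π | F n m e x = 0} :=
      Real.injOn_cos.mono fun x hx => hx.1
    have hmaps : ∀ x ∈ {x ∈ Set.Icc 0 π | F n m e x = 0},
        Real.cos x ∈ (P.roots.toFinset : Set ℝ) := by
      intro x hx
      simp only [Finset.mem_coe, Multiset.mem_toFinset, Polynomial.mem_roots h0,
        Polynomial.IsRoot.def, heval]
      exact hx.2
    have h1 := Set.ncard_le_ncard_of_injOn Real.cos hmaps hinj (Finset.finite_toSet _)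
    rw [Set.ncard_coe_finset] at h1
    exact h1.trans ((Multiset.toFinset_card_le _).trans ((Polynomial.card_roots' _).trans hdeg))

lemma zeros_F_two_pi_le (n m : ℕ) (e : Fin (m + 1) → Bool) :
    zeros (F n m e) (Set.Icc 0 (2 * π)) ≤ 2 * zeros (F n m e) (Set.Icc 0 π) := by
  have hsymm : ∀ x, F n m e (2 * π - x) = F n m e x := by
    intro x
    have h : ∀ k : ℕ, Real.cos (k * (2 * π - x)) = Real.cos (k * x) := by
      intro k
      rw [mul_sub, Real.cos_nat_mul_two_pi_sub]
    simp only [F, Dker, h]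
  set A := {x ∈ Set.Icc 0 π | F n m e x = 0} with hA
  by_cases hfin : A.Finite
  · have hsub : {x ∈ Set.Icc 0 (2 * π) | F n m e x = 0} ⊆ A ∪ (fun x => 2 * π - x) '' A := by
      rintro x ⟨hx, hx0⟩
      rcases le_total x π with h | h
      · exact Or.inl ⟨⟨hx.1, h⟩, hx0⟩
      · refine Or.inr ⟨2 * π - x, ⟨⟨by linarith [hx.2], by linarith⟩, ?_⟩, by ring⟩
        rw [hsymm, hx0]
    calc _ ≤ (A ∪ (fun x => 2 * π - x) '' A).ncard :=
          Set.ncard_le_ncard hsub (hfin.union (hfin.image _))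
      _ ≤ A.ncard + ((fun x => 2 * π - x) '' A).ncard := Set.ncard_union_le _ _
      _ ≤ A.ncard + A.ncard := Nat.add_le_add_left (Set.ncard_image_le hfin) _
      _ = _ := (two_mul _).symm
  · have : ¬ {x ∈ Set.Icc 0 (2 * π) | F n m e x = 0}.Finite := fun h => hfin <|
      h.subset fun x hx => ⟨⟨hx.1.1, by linarith [hx.1.2, Real.pi_pos]⟩, hx.2⟩
    rw [zeros, Set.Infinite.ncard this]
    exact Nat.zero_le _

open Classical in
/-- Zeros in `[0, π]` are counted over a cover by short intervals: an interval contributes at most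
`6` unless it has at least `7` zeros. -/
lemma zeros_F_le_sum {n m : ℕ} (hmn : m ≤ n) (e : Fin (m + 1) → Bool) {ℓ : ℝ} (hℓ : 0 < ℓ)
    {L : ℕ} (hL : π < L * ℓ) :
    (zeros (F n m e) (Set.Icc 0 π) : ℝ) ≤ ∑ i ∈ Finset.range L,
      (6 * (if HasZeros (F n m e) (Set.Icc (i * ℓ) (i * ℓ + ℓ)) 1 then (1 : ℝ) else 0) +
        n * (if HasZeros (F n m e) (Set.Icc (i * ℓ) (i * ℓ + ℓ)) 7 then (1 : ℝ) else 0)) := by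
  set A := {x ∈ Set.Icc 0 π | F n m e x = 0} with hA
  by_cases hfin : A.Finite
  swap
  · rw [zeros, Set.Infinite.ncard hfin, Nat.cast_zero]
    exact Finset.sum_nonneg fun i _ => by positivity
  let N : ℕ → Set ℝ := fun i => {x ∈ A | x ∈ Set.Icc (i * ℓ) (i * ℓ + ℓ)}
  have hsub : A ⊆ ⋃ i ∈ Finset.range L, N i := by
    intro x hx
    have hx0 : 0 ≤ x / ℓ := div_nonneg hx.1.1 hℓ.le
    have h1 := Nat.floor_le hx0
    have h2 := Nat.lt_floor_add_one (x / ℓ)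
    rw [le_div_iff₀ hℓ] at h1
    rw [div_lt_iff₀ hℓ] at h2
    simp only [Set.mem_iUnion, Finset.mem_range]
    refine ⟨⌊x / ℓ⌋₊, ?_, hx, h1, by linarith⟩
    rw [Nat.floor_lt hx0, div_lt_iff₀ hℓ]
    linarith [hx.1.2]
  have hcard : A.ncard ≤ ∑ i ∈ Finset.range L, (N i).ncard := by
    refine (Set.ncard_le_ncard hsub ?_).trans (Finset.set_ncard_biUnion_le _ _)
    exact (Finset.range L).finite_toSet.biUnion fun i _ => hfin.subset fun x hx => hx.1
  have hbound : ∀ i, ((N i).ncard : ℝ) ≤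
      6 * (if HasZeros (F n m e) (Set.Icc (i * ℓ) (i * ℓ + ℓ)) 1 then (1 : ℝ) else 0) +
        n * (if HasZeros (F n m e) (Set.Icc (i * ℓ) (i * ℓ + ℓ)) 7 then (1 : ℝ) else 0) := by
    intro i
    have hex : ∀ r ≤ (N i).ncard, HasZeros (F n m e) (Set.Icc (i * ℓ) (i * ℓ + ℓ)) r := by
      intro r hr
      obtain ⟨z, hz, hz'⟩ := hasZeros_of_le_ncard (f := F n m e)
        (s := Set.Icc 0 π ∩ Set.Icc (i * ℓ) (i * ℓ + ℓ)) (r := r) (by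
          refine hr.trans (le_of_eq ?_)
          congr 1
          ext x
          simp only [N, hA, Set.mem_ofPred_eq, Set.mem_inter_iff]
          tauto)
      exact ⟨z, hz, fun k => ⟨(hz' k).1.2, (hz' k).2⟩⟩
    have hn : (N i).ncard ≤ n :=
      (Set.ncard_le_ncard (fun x hx => hx.1) hfin).trans (zeros_F_Icc_pi_le hmn e)
    have hn' : ((N i).ncard : ℝ) ≤ n := by exact_mod_cast hn
    rcases Nat.lt_or_ge (N i).ncard 7 with h7 | h7
    · rcases Nat.eq_zero_or_pos (N i).ncard with h0 | h0
      · rw [h0, Nat.cast_zero]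
        positivity
      · rw [if_pos (hex 1 h0)]
        have h6 : ((N i).ncard : ℝ) ≤ 6 := by exact_mod_cast (by omega : (N i).ncard ≤ 6)
        have : (0 : ℝ) ≤ n * (if HasZeros (F n m e) (Set.Icc (i * ℓ) (i * ℓ + ℓ)) 7
          then (1 : ℝ) else 0) := by positivity
        linarith
    · rw [if_pos (hex 7 h7), if_pos (hex 1 (by omega))]
      linarith
  calc (zeros (F n m e) (Set.Icc 0 π) : ℝ) ≤ ((∑ i ∈ Finset.range L, (N i).ncard : ℕ) : ℝ) := by
        exact_mod_cast hcard
    _ = ∑ i ∈ Finset.range L, ((N i).ncard : ℝ) := by push_cast; rfl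
    _ ≤ _ := Finset.sum_le_sum fun i _ => hbound i

end Zeros

/-! ### Probability of having zeros in a short interval -/

section ShortIntervals

lemma bitProb_abs_le {ι : Type*} [Fintype ι] [DecidableEq ι] (a : ι → ℝ) (b : ℝ) {K R : ℝ}
    (hK : 0 < K) (hR : 1 ≤ R) (ha : ∀ k, |a k| ≤ 1) (hV : K ^ 2 ≤ ∑ k, a k ^ 2) :
    bitProb {e : ι → Bool | |∑ k, (if e k then (1 : ℝ) else 0) * a k + b| ≤ R} ≤ 400 * (R / K) := by
  have h := bitProb_smallBall one_pos (fun k (_ : Fin 1) => a k) (fun _ => b) hK hR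
    (fun k _ => ha k) (fun ξ => by
      simp only [Finset.univ_unique, Finset.sum_singleton, mul_pow, ← Finset.mul_sum]
      rw [mul_comm]
      gcongr)
  refine (bitProb_mono fun e he => ?_).trans (h.trans (le_of_eq ?_))
  · intro _
    exact he
  · norm_num

lemma div_pow_mul_le {m q n : ℝ} (hm : 0 < m) (hq : 1 ≤ q) (hbig : 2 * (n + 1) * n ^ 7 ≤ m ^ 7 * q ^ 5)
    {j : ℕ} (hj : j ≤ 2) : (1 / (m * q)) ^ (7 - j) * (2 * (n + 1) * n ^ 7) ≤ m ^ j := by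
  have hq0 : 0 < q := by linarith
  calc (1 / (m * q)) ^ (7 - j) * (2 * (n + 1) * n ^ 7)
      ≤ (1 / (m * q)) ^ (7 - j) * (m ^ 7 * q ^ 5) := by gcongr
    _ = m ^ j * (q ^ 5 / q ^ (7 - j)) := by
        have : m ^ 7 = m ^ (7 - j) * m ^ j := by rw [← pow_add]; congr 1; omega
        rw [this, one_div, inv_pow, mul_pow]
        field_simp
    _ ≤ m ^ j * 1 := by
        gcongr
        rw [div_le_one (by positivity)]
        exact pow_le_pow_right₀ hq (by omega)
    _ = m ^ j := mul_one _

lemma abs_Fjet_le_of_hasZeros {n m : ℕ} (hm : 0 < m) (hmn : m ≤ n) {q : ℝ} (hq : 1 ≤ q)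
    (hbig : 2 * ((n : ℝ) + 1) * (n : ℝ) ^ 7 ≤ (m : ℝ) ^ 7 * q ^ 5) {x : ℝ}
    {e : Fin (m + 1) → Bool}
    (he : HasZeros (F n m e) (Set.Icc x (x + 1 / (m * q))) 7) {j : ℕ} (hj : j ≤ 2) :
    |Fjet n m e j x| ≤ (m : ℝ) ^ j := by
  have hm0 : (0 : ℝ) < m := by exact_mod_cast hm
  have hq0 : 0 < q := by linarith
  rw [← Fjet_zero] at he
  have hℓ : 0 ≤ 1 / ((m : ℝ) * q) := by positivity
  have h := he.abs_le (hasDerivAt_Fjet n m e) hℓ (by positivity)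
    (abs_Fjet_le hmn e 7) (s := 7 - j) (by omega) x ⟨le_rfl, by linarith⟩
  have : 7 - (7 - j) = j := by omega
  rw [this] at h
  exact h.trans (div_pow_mul_le hm0 hq hbig hj)

lemma bitProb_hasZeros_seven_le {n m : ℕ} (hm : 0 < m) (hmn : m ≤ n) {q : ℝ} (hq : 1 ≤ q)
    (hqm : q ^ 4 ≤ m)
    (hbig : 2 * ((n : ℝ) + 1) * (n : ℝ) ^ 7 ≤ (m : ℝ) ^ 7 * q ^ 5) (x : ℝ) :
    bitProb {e | HasZeros (F n m e) (Set.Icc x (x + 1 / (m * q))) 7} ≤ 1600 / q ^ 2 := by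
  have hq0 : 0 < q := by linarith
  have h := bitProb_abs_le (fun k : Fin (m + 1) => Real.cos ((k : ℕ) * x)) (-Dker n x)
    (K := q ^ 2 / 4) (R := 1) (by positivity) le_rfl (fun k => Real.abs_cos_le_one _) (by
      rw [Fin.sum_univ_eq_sum_range (fun k => Real.cos (k * x) ^ 2) (m + 1)]
      refine le_trans ?_ (le_sum_cos_sq m x)
      rw [div_pow, ← pow_mul]
      norm_num
      linarith)
  refine (bitProb_mono fun e he => ?_).trans (h.trans (le_of_eq ?_))
  · have h1 := abs_Fjet_le_of_hasZeros hm hmn hq hbig he (j := 0) (by norm_num)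
    rw [Fjet_zero, pow_zero, F, abs_sub_comm, sub_eq_add_neg] at h1
    exact h1
  · field_simp
    norm_num

lemma bitProb_hasZeros_seven_le_of_sin {n m : ℕ} (hm : 0 < m) (hmn : m ≤ n) {q : ℝ} (hq : 1 ≤ q)
    (hqm : q ^ 4 ≤ m)
    (hbig : 2 * ((n : ℝ) + 1) * (n : ℝ) ^ 7 ≤ (m : ℝ) ^ 7 * q ^ 5) {x : ℝ}
    (hx : 768 ≤ m * |Real.sin x|) :
    bitProb {e | HasZeros (F n m e) (Set.Icc x (x + 1 / (m * q))) 7} ≤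
      4 * 300 ^ 3 * 23 ^ 3 / q ^ 6 := by
  have hq0 : 0 < q := by linarith
  have hm0 : (0 : ℝ) < m := by exact_mod_cast hm
  let v : Fin (m + 1) → Fin 3 → ℝ := fun k i =>
    (((k : ℕ) : ℝ) / m) ^ (i : ℕ) * Real.cos ((k : ℕ) * x + (i : ℕ) * (π / 2))
  let b : Fin 3 → ℝ := fun i => -((∑ k ∈ Finset.range (n + 1),
    (k : ℝ) ^ (i : ℕ) * Real.cos (k * x + (i : ℕ) * (π / 2))) / (m : ℝ) ^ (i : ℕ))
  have h := bitProb_smallBall (by norm_num : 0 < 3) v b (K := q ^ 2 / 23) (R := 1) (by positivity)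
    le_rfl (fun k i => by
      simp only [v]
      rw [abs_mul, abs_pow, abs_of_nonneg (by positivity)]
      have h1 : ((k : ℕ) : ℝ) / m ≤ 1 := by
        rw [div_le_one hm0]
        exact_mod_cast Nat.lt_succ_iff.mp k.2
      exact mul_le_one₀ (pow_le_one₀ (by positivity) h1) (abs_nonneg _) (Real.abs_cos_le_one _))
    (fun ξ => by
      simp only [v]
      rw [Fin.sum_univ_eq_sum_range (fun k => (∑ i : Fin 3, ξ i *
        (((k : ℝ) / m) ^ (i : ℕ) * Real.cos (k * x + (i : ℕ) * (π / 2)))) ^ 2) (m + 1)]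
      refine le_trans ?_ (le_sum_jet_sq hm hx ξ)
      have : (q ^ 2 / 23) ^ 2 ≤ m / 512 := by
        rw [div_pow, ← pow_mul]
        norm_num
        rw [div_le_div_iff₀ (by norm_num) (by norm_num)]
        nlinarith
      gcongr)
  refine (bitProb_mono fun e he => ?_).trans (h.trans (le_of_eq ?_))
  · intro i
    have h1 := abs_Fjet_le_of_hasZeros hm hmn hq hbig he (j := i) (by omega)
    have h2 : ∑ k, (if e k then (1 : ℝ) else 0) * v k i + b i =
        -(Fjet n m e i x / (m : ℝ) ^ (i : ℕ)) := by
      simp only [v, b, Fjet, sub_div, Finset.sum_div (Finset.univ : Finset (Fin (m + 1)))]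
      rw [neg_sub, ← sub_eq_add_neg]
      congr 1
      refine Finset.sum_congr rfl fun k _ => ?_
      rw [div_pow]
      ring
    rw [h2, abs_neg, abs_div, abs_of_pos (by positivity : 0 < (m : ℝ) ^ (i : ℕ)),
      div_le_one (by positivity)]
    exact h1
  · field_simp
    norm_num

/-- The contribution of the frequencies in `B` to the centred random part of `Fjet`. -/
noncomputable def noise {m : ℕ} (B : Finset (Fin (m + 1))) (e : Fin (m + 1) → Bool) (j : ℕ)
    (x : ℝ) : ℝ :=
  ∑ k, (1 / 2 - (if e k then (1 : ℝ) else 0)) *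
    (if k ∈ B then ((k : ℕ) : ℝ) ^ j * Real.cos ((k : ℕ) * x + j * (π / 2)) else 0)

lemma bitAvg_abs_noise_le {m : ℕ} (hm : 0 < m) {q : ℝ} (hq : 1 ≤ q) (hmq : m ≤ 16 * q ^ 4)
    (B : Finset (Fin (m + 1))) {j : ℕ} (hj : 1 ≤ j) (x : ℝ) :
    bitAvg (fun e => (1 / (m * q)) ^ j * |noise B e j x|) ≤ 9 * q := by
  have hq0 : 0 < q := by linarith
  have hm0 : (0 : ℝ) < m := by exact_mod_cast hm
  set ℓ : ℝ := (1 / (m * q)) ^ j with hℓ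
  have hℓ0 : 0 ≤ ℓ := by positivity
  have h1 : ∀ e, ℓ * |noise B e j x| ≤ q / 2 + ℓ ^ 2 / (2 * q) * noise B e j x ^ 2 := by
    intro e
    have h2 : q / 2 + ℓ ^ 2 / (2 * q) * noise B e j x ^ 2 - ℓ * |noise B e j x| =
        (q - ℓ * |noise B e j x|) ^ 2 / (2 * q) := by
      rw [← sq_abs (noise B e j x)]
      field_simp
      ring
    have h3 : 0 ≤ (q - ℓ * |noise B e j x|) ^ 2 / (2 * q) := by positivity
    linarith
  refine (bitAvg_mono h1).trans ?_
  rw [bitAvg_add, bitAvg_const, bitAvg_const_mul]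
  simp only [noise]
  rw [bitAvg_sq_sum]
  have h4 : ∑ k : Fin (m + 1), (if k ∈ B then ((k : ℕ) : ℝ) ^ j *
      Real.cos ((k : ℕ) * x + j * (π / 2)) else 0) ^ 2 ≤ 2 * m * ((m : ℝ) ^ j) ^ 2 := by
    refine (Finset.sum_le_sum (g := fun _ => ((m : ℝ) ^ j) ^ 2) fun k _ => ?_).trans ?_
    · split_ifs
      · rw [mul_pow]
        have hk : ((k : ℕ) : ℝ) ≤ m := by exact_mod_cast Nat.lt_succ_iff.mp k.2
        calc _ ≤ ((m : ℝ) ^ j) ^ 2 * 1 := by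
              gcongr
              exact Real.cos_sq_le_one _
          _ = _ := mul_one _
      · rw [zero_pow two_ne_zero]
        positivity
    · simp only [Finset.sum_const, Finset.card_univ, Fintype.card_fin, nsmul_eq_mul]
      push_cast
      have : (1 : ℝ) ≤ m := by exact_mod_cast hm
      gcongr
      linarith
  have h5 : ℓ ^ 2 * ((m : ℝ) ^ j) ^ 2 ≤ 1 / q ^ 2 := by
    have : ℓ * (m : ℝ) ^ j = 1 / q ^ j := by
      rw [hℓ, ← mul_pow, ← one_div_pow]
      congr 1
      field_simp
    rw [← mul_pow, this, div_pow, one_pow]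
    gcongr
    exact le_self_pow₀ hq (by omega)
  calc q / 2 + ℓ ^ 2 / (2 * q) * (_ / 4)
      ≤ q / 2 + ℓ ^ 2 / (2 * q) * ((2 * m * ((m : ℝ) ^ j) ^ 2) / 4) := by gcongr
    _ = q / 2 + m / (4 * q) * (ℓ ^ 2 * ((m : ℝ) ^ j) ^ 2) := by field_simp
    _ ≤ q / 2 + (16 * q ^ 4) / (4 * q) * (1 / q ^ 2) := by gcongr
    _ = q / 2 + 4 * q := by field_simp; ring
    _ ≤ 9 * q := by linarith

/-- Anticoncentration at a random level which depends only on the frequencies in `B`. -/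
lemma bitProb_abs_F_le_noise {n m : ℕ} (hm : 0 < m) {q : ℝ} (hq : 1 ≤ q) (hmq : m ≤ 16 * q ^ 4)
    {x : ℝ} (B : Finset (Fin (m + 1)))
    (hB : (q ^ 2 / 3) ^ 2 ≤ ∑ k, (if k ∈ B then 0 else Real.cos ((k : ℕ) * x)) ^ 2) :
    bitProb {e | |F n m e x| ≤ 19 * q + 2 * ((1 / (m * q)) ^ 1 * |noise B e 1 x| +
      (1 / (m * q)) ^ 2 * |noise B e 2 x| + (1 / (m * q)) ^ 3 * |noise B e 3 x|)} ≤
      87600 / q := by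
  have hq0 : 0 < q := by linarith
  have hm0 : (0 : ℝ) < m := by exact_mod_cast hm
  let Y : (Fin (m + 1) → Bool) → ℝ := fun e => (1 / (m * q)) ^ 1 * |noise B e 1 x| +
      (1 / (m * q)) ^ 2 * |noise B e 2 x| + (1 / (m * q)) ^ 3 * |noise B e 3 x|
  have hY0 : ∀ e, 0 ≤ Y e := fun e => by positivity
  have hYavg : bitAvg Y ≤ 27 * q := by
    simp only [Y]
    rw [bitAvg_add, bitAvg_add]
    have h1 := bitAvg_abs_noise_le hm hq hmq B (j := 1) le_rfl x
    have h2 := bitAvg_abs_noise_le hm hq hmq B (j := 2) (by norm_num) x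
    have h3 := bitAvg_abs_noise_le hm hq hmq B (j := 3) (by norm_num) x
    linarith
  have hYB : ∀ e e' : Fin (m + 1) → Bool, Y (fun k => if k ∈ B then e k else e' k) = Y e := by
    intro e e'
    have : ∀ j, noise B (fun k => if k ∈ B then e k else e' k) j x = noise B e j x := by
      intro j
      refine Finset.sum_congr rfl fun k _ => ?_
      by_cases hk : k ∈ B <;> simp [hk]
    simp only [Y, this]
  change bitProb {e | |F n m e x| ≤ 19 * q + 2 * Y e} ≤ _
  rw [bitProb, ← bitAvg_resample B]
  have hinner : ∀ e : Fin (m + 1) → Bool, bitAvg (fun e' : Fin (m + 1) → Bool =>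
      Set.indicator {e | |F n m e x| ≤ 19 * q + 2 * Y e} (1 : (Fin (m + 1) → Bool) → ℝ)
        (fun k => if k ∈ B then e k else e' k)) ≤ 22800 / q + 2400 / q ^ 2 * Y e := by
    intro e
    have h := bitProb_abs_le (fun k : Fin (m + 1) => if k ∈ B then 0 else Real.cos ((k : ℕ) * x))
      (∑ k : Fin (m + 1), (if e k then (1 : ℝ) else 0) *
        (if k ∈ B then Real.cos ((k : ℕ) * x) else 0) - Dker n x)
      (K := q ^ 2 / 3) (R := 19 * q + 2 * Y e) (by positivity) (by linarith [hY0 e])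
      (fun k => by split_ifs <;> simp [Real.abs_cos_le_one]) hB
    refine le_trans (le_of_eq ?_) (h.trans (le_of_eq ?_))
    · refine congrArg bitAvg (funext fun e' => ?_)
      have hF : F n m (fun k => if k ∈ B then e k else e' k) x =
          -(∑ k : Fin (m + 1), (if e' k then (1 : ℝ) else 0) *
            (if k ∈ B then 0 else Real.cos ((k : ℕ) * x)) +
          (∑ k : Fin (m + 1), (if e k then (1 : ℝ) else 0) *
            (if k ∈ B then Real.cos ((k : ℕ) * x) else 0) - Dker n x)) := by
        rw [← add_sub_assoc, neg_sub, ← Finset.sum_add_distrib, F]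
        congr 1
        refine Finset.sum_congr rfl fun k _ => ?_
        by_cases hk : k ∈ B <;> simp [hk]
      simp only [Set.indicator_apply, Set.mem_ofPred_eq, hYB, hF, abs_neg, Pi.one_apply]
    · field_simp
      ring
  refine (bitAvg_mono hinner).trans ?_
  rw [bitAvg_add, bitAvg_const, bitAvg_const_mul]
  calc 22800 / q + 2400 / q ^ 2 * bitAvg Y ≤ 22800 / q + 2400 / q ^ 2 * (27 * q) := by gcongr
    _ = 87600 / q := by field_simp; norm_num

lemma Fjet_eq_add_noise {n m : ℕ} (B : Finset (Fin (m + 1))) (e : Fin (m + 1) → Bool) (j : ℕ)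
    (x : ℝ) : Fjet n m e j x =
      (∑ k ∈ Finset.range (n + 1), (k : ℝ) ^ j * Real.cos (k * x + j * (π / 2)) -
        (∑ k ∈ Finset.range (m + 1), (k : ℝ) ^ j * Real.cos (k * x + j * (π / 2))) / 2) +
      (noise B e j x + noise Bᶜ e j x) := by
  rw [noise, noise, ← Finset.sum_add_distrib, Fjet,
    ← Fin.sum_univ_eq_sum_range (fun k => (k : ℝ) ^ j * Real.cos (k * x + j * (π / 2))) (m + 1),
    Finset.sum_div, sub_eq_add_neg, sub_eq_add_neg, add_assoc, ← Finset.sum_neg_distrib,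
    ← Finset.sum_neg_distrib, ← Finset.sum_add_distrib]
  congr 1
  refine Finset.sum_congr rfl fun k _ => ?_
  by_cases hk : k ∈ B <;> cases e k <;> simp [hk] <;> ring

lemma abs_Fjet_le_noise {n m : ℕ} (hm : 0 < m) (hmn : m ≤ n) {q : ℝ} (hq : 1 ≤ q)
    (hnq : n ≤ m * q) {x : ℝ} (hx : 1 / (2 * q) ≤ |Real.sin x|) (B : Finset (Fin (m + 1)))
    (e : Fin (m + 1) → Bool) (j : ℕ) :
    (1 / (m * q)) ^ j * |Fjet n m e j x| ≤
      6 * q + ((1 / (m * q)) ^ j * |noise B e j x| + (1 / (m * q)) ^ j * |noise Bᶜ e j x|) := by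
  have hq0 : 0 < q := by linarith
  have hm0 : (0 : ℝ) < m := by exact_mod_cast hm
  have hs : 1 / (4 * q) ≤ |Real.sin (x / 2)| := by
    have h1 : Real.sin x = 2 * Real.sin (x / 2) * Real.cos (x / 2) := by
      rw [← Real.sin_two_mul]; ring_nf
    rw [h1, abs_mul, abs_mul, abs_two] at hx
    have h2 := mul_le_mul_of_nonneg_left (Real.abs_cos_le_one (x / 2))
      (by positivity : 0 ≤ 2 * |Real.sin (x / 2)|)
    have h3 : 1 / (2 * q) = 2 * (1 / (4 * q)) := by field_simp; norm_num
    linarith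
  have hsum : ∀ N : ℕ, |∑ k ∈ Finset.range (N + 1), (k : ℝ) ^ j * Real.cos (k * x + j * (π / 2))| ≤
      4 * q * (N : ℝ) ^ j := by
    intro N
    have h1 := abs_sin_half_mul_abs_sum_mul_cos_le (a := fun k : ℕ => (k : ℝ) ^ j)
      (fun k l hkl => by
        have : (k : ℝ) ≤ l := by exact_mod_cast hkl
        change (k : ℝ) ^ j ≤ (l : ℝ) ^ j
        gcongr) (by positivity) x (j * (π / 2)) N
    have h2 := (mul_le_mul_of_nonneg_right hs (abs_nonneg _)).trans h1
    rw [one_div, inv_mul_le_iff₀ (by positivity)] at h2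
    exact h2
  have hn := hsum n
  have hm' := hsum m
  have hmn' : (m : ℝ) ^ j ≤ (n : ℝ) ^ j := by gcongr
  have hdet : |∑ k ∈ Finset.range (n + 1), (k : ℝ) ^ j * Real.cos (k * x + j * (π / 2)) -
      (∑ k ∈ Finset.range (m + 1), (k : ℝ) ^ j * Real.cos (k * x + j * (π / 2))) / 2| ≤
      6 * q * (n : ℝ) ^ j := by
    refine (abs_sub _ _).trans ?_
    rw [abs_div, abs_two]
    have := mul_le_mul_of_nonneg_left hmn' (by positivity : 0 ≤ 4 * q)
    linarith
  have hℓ0 : 0 ≤ (1 / (m * q)) ^ j := by positivity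
  have hdet2 : (1 / (m * q)) ^ j * (6 * q * (n : ℝ) ^ j) ≤ 6 * q := by
    have h1 : (1 / (m * q)) ^ j * (n : ℝ) ^ j ≤ 1 := by
      rw [← mul_pow]
      refine pow_le_one₀ (by positivity) ?_
      rw [one_div, inv_mul_le_iff₀ (by positivity), mul_one]
      exact hnq
    calc _ = 6 * q * ((1 / (m * q)) ^ j * (n : ℝ) ^ j) := by ring
      _ ≤ 6 * q * 1 := by gcongr
      _ = 6 * q := mul_one _
  rw [Fjet_eq_add_noise B]
  have h3 := (abs_add_le (∑ k ∈ Finset.range (n + 1), (k : ℝ) ^ j * Real.cos (k * x + j * (π / 2)) -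
      (∑ k ∈ Finset.range (m + 1), (k : ℝ) ^ j * Real.cos (k * x + j * (π / 2))) / 2)
      (noise B e j x + noise Bᶜ e j x)).trans
      (add_le_add hdet (abs_add_le (noise B e j x) (noise Bᶜ e j x)))
  have h4 := mul_le_mul_of_nonneg_left h3 hℓ0
  rw [mul_add, mul_add] at h4
  linarith

lemma bitProb_hasZeros_one_le {n m : ℕ} (hm : 0 < m) (hmn : m ≤ n) {q : ℝ} (hq : 3 ≤ q)
    (hqm : q ^ 4 ≤ m) (hmq : m ≤ 16 * q ^ 4) (hnq : n ≤ m * q)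
    (hbig : 2 * ((n : ℝ) + 1) * (n : ℝ) ^ 7 ≤ (m : ℝ) ^ 7 * q ^ 5)
    {x : ℝ} (hx : 1 / (2 * q) ≤ |Real.sin x|) :
    bitProb {e | HasZeros (F n m e) (Set.Icc x (x + 1 / (m * q))) 1} ≤ 175200 / q := by
  have hq0 : 0 < q := by linarith
  have hq1 : 1 ≤ q := by linarith
  have hm0 : (0 : ℝ) < m := by exact_mod_cast hm
  have hn0 : (0 : ℝ) < n := by exact_mod_cast hm.trans_le hmn
  set h : ℕ := (m + 1) / 2 with hh
  set B : Finset (Fin (m + 1)) := Finset.univ.filter fun k => (k : ℕ) < h with hBdef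
  have hlen : (m : ℝ) / 2 ≤ h ∧ (h : ℝ) ≤ (m + 1) / 2 := by
    constructor
    · rw [div_le_iff₀ two_pos]
      exact_mod_cast (by omega : m ≤ h * 2)
    · rw [le_div_iff₀ two_pos]
      exact_mod_cast (by omega : h * 2 ≤ m + 1)
  have hsin0 : 0 < |Real.sin x| := lt_of_lt_of_le (by positivity) hx
  have hsq : 1 / (2 * |Real.sin x|) ≤ q := by
    rw [div_le_iff₀ (by positivity)]
    rw [div_le_iff₀ (by positivity)] at hx
    linarith
  have hcos := fun N => (abs_le.mp ((abs_sum_cos_sq_sub_le (abs_pos.mp hsin0) N).trans hsq))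
  have hq3 : 9 * q ≤ q ^ 4 / 3 := by
    have : (3 : ℝ) ^ 3 ≤ q ^ 3 := by gcongr
    nlinarith
  have hfirst : ∑ k : Fin (m + 1), (if k ∈ B then Real.cos ((k : ℕ) * x) ^ 2 else 0) =
      ∑ k ∈ Finset.range h, Real.cos (k * x) ^ 2 := by
    simp only [hBdef, Finset.mem_filter, Finset.mem_univ, true_and]
    rw [Fin.sum_univ_eq_sum_range (fun k => if k < h then Real.cos (k * x) ^ 2 else 0) (m + 1),
      ← Finset.sum_filter]
    congr 1
    ext k
    simp only [Finset.mem_filter, Finset.mem_range]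
    omega
  have htotal : ∑ k : Fin (m + 1), (if k ∈ B then Real.cos ((k : ℕ) * x) ^ 2 else 0) +
      ∑ k : Fin (m + 1), (if k ∈ B then 0 else Real.cos ((k : ℕ) * x) ^ 2) =
      ∑ k ∈ Finset.range (m + 1), Real.cos (k * x) ^ 2 := by
    rw [← Finset.sum_add_distrib, ← Fin.sum_univ_eq_sum_range (fun k => Real.cos (k * x) ^ 2)]
    refine Finset.sum_congr rfl fun k _ => ?_
    split_ifs <;> simp
  have hB1 : (q ^ 2 / 3) ^ 2 ≤
      ∑ k : Fin (m + 1), (if k ∈ B then 0 else Real.cos ((k : ℕ) * x)) ^ 2 := by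
    simp only [ite_pow, zero_pow two_ne_zero]
    have h1 := (hcos (m + 1)).1
    have h2 := (hcos h).2
    push_cast at h1
    rw [div_pow, ← pow_mul]
    norm_num
    linarith [hlen.2]
  have hB2 : (q ^ 2 / 3) ^ 2 ≤
      ∑ k : Fin (m + 1), (if k ∈ Bᶜ then 0 else Real.cos ((k : ℕ) * x)) ^ 2 := by
    simp only [Finset.mem_compl, ite_not, ite_pow, zero_pow two_ne_zero]
    have h2 := (hcos h).1
    rw [hfirst, div_pow, ← pow_mul]
    norm_num
    linarith [hlen.1]
  have hlast : (1 / ((m : ℝ) * q)) ^ 4 * (2 * ((n : ℝ) + 1) * (n : ℝ) ^ 4) ≤ q := by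
    have h1 : 2 * ((n : ℝ) + 1) * (n : ℝ) ^ 4 ≤ (m : ℝ) ^ 4 * q ^ 5 := by
      have h2 : (m : ℝ) ^ 7 * q ^ 5 ≤ (n : ℝ) ^ 3 * ((m : ℝ) ^ 4 * q ^ 5) := by
        have : (m : ℝ) ^ 3 ≤ (n : ℝ) ^ 3 := by gcongr
        calc (m : ℝ) ^ 7 * q ^ 5 = (m : ℝ) ^ 3 * ((m : ℝ) ^ 4 * q ^ 5) := by ring
          _ ≤ _ := by gcongr
      have h3 : (n : ℝ) ^ 3 * (2 * ((n : ℝ) + 1) * (n : ℝ) ^ 4) ≤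
          (n : ℝ) ^ 3 * ((m : ℝ) ^ 4 * q ^ 5) := by
        refine le_trans (le_of_eq ?_) (hbig.trans h2)
        ring
      exact le_of_mul_le_mul_left h3 (by positivity)
    calc _ ≤ (1 / ((m : ℝ) * q)) ^ 4 * ((m : ℝ) ^ 4 * q ^ 5) := by gcongr
      _ = q := by field_simp
  have hP1 := bitProb_abs_F_le_noise (n := n) hm hq1 hmq B hB1
  have hP2 := bitProb_abs_F_le_noise (n := n) hm hq1 hmq Bᶜ hB2
  refine (bitProb_mono fun e he => ?_).trans
    ((bitProb_union_le _ _).trans ((add_le_add hP1 hP2).trans (le_of_eq ?_)))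
  · change HasZeros (F n m e) _ 1 at he
    rw [← Fjet_zero] at he
    have ht := he.abs_le_taylor (hasDerivAt_Fjet n m e) (by positivity) (by positivity)
      (abs_Fjet_le hmn e 4)
    have t1 := abs_Fjet_le_noise hm hmn hq1 hnq hx B e 1
    have t2 := abs_Fjet_le_noise hm hmn hq1 hnq hx B e 2
    have t3 := abs_Fjet_le_noise hm hmn hq1 hnq hx B e 3
    rw [Fjet_zero] at ht
    simp only [pow_one] at t1
    simp only [Set.mem_union, Set.mem_ofPred_eq, pow_one]
    by_contra! hcon
    linarith [hcon.1, hcon.2]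
  · field_simp
    norm_num

end ShortIntervals

/-! ### The expected number of zeros -/

section Expectation

lemma mul_le_sin_of_mem {t x : ℝ} (ht : 0 ≤ t) (hx : t ≤ x) (hx' : x ≤ π - t) :
    5 / 8 * t ≤ Real.sin x := by
  have key : ∀ y, t ≤ y → y ≤ π / 2 → 5 / 8 * t ≤ Real.sin y := by
    intro y hty hy
    have h1 := Real.mul_le_sin (ht.trans hty) hy
    have h2 : (5 : ℝ) / 8 ≤ 2 / π := by
      rw [le_div_iff₀ Real.pi_pos]
      linarith [Real.pi_lt_d2]
    calc 5 / 8 * t ≤ 2 / π * y := by gcongr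
      _ ≤ _ := h1
  rcases le_total x (π / 2) with h | h
  · exact key x hx h
  · rw [← Real.sin_pi_sub]
    exact key _ (by linarith) (by linarith)

lemma pow_le_pow_of_rpow_le {n m : ℕ} (h : (n : ℝ) ^ (0.99 : ℝ) ≤ m) : n ^ 99 ≤ m ^ 100 := by
  have h1 : ((n : ℝ) ^ (0.99 : ℝ)) ^ 100 ≤ (m : ℝ) ^ 100 := by gcongr
  rw [← Real.rpow_mul_natCast (by positivity)] at h1
  have h2 : ((0.99 : ℝ) * (100 : ℕ)) = (99 : ℕ) := by norm_num
  rw [h2, Real.rpow_natCast] at h1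
  exact_mod_cast h1

set_option exponentiation.threshold 700 in
lemma two_mul_succ_mul_pow_le {n m q : ℕ} (hn : 0 < n) (h : n ^ 99 ≤ m ^ 100)
    (hmq : m ≤ 16 * q ^ 4) (hq : 1024 ≤ q) : 2 * (n + 1) * n ^ 7 ≤ m ^ 7 * q ^ 5 := by
  have h1 : 2 * (n + 1) * n ^ 7 ≤ 4 * n ^ 8 := by
    calc 2 * (n + 1) * n ^ 7 ≤ 2 * (n + n) * n ^ 7 := by gcongr; omega
      _ = 4 * n ^ 8 := by ring
  refine h1.trans ?_
  rw [← Nat.pow_le_pow_iff_left (n := 99) (by norm_num)]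
  have h2 : (2 : ℕ) ^ 626 ≤ q ^ 67 := by
    calc (2 : ℕ) ^ 626 ≤ 2 ^ (10 * 67) := Nat.pow_le_pow_right (by norm_num) (by norm_num)
      _ = 1024 ^ 67 := by rw [show (1024 : ℕ) = 2 ^ 10 by norm_num, ← pow_mul]
      _ ≤ q ^ 67 := Nat.pow_le_pow_left hq _
  calc (4 * n ^ 8) ^ 99 = 2 ^ 198 * (n ^ 99) ^ 8 := by
        rw [mul_pow, ← pow_mul, ← pow_mul, show (4 : ℕ) = 2 ^ 2 by norm_num, ← pow_mul]
    _ ≤ 2 ^ 198 * (m ^ 100) ^ 8 := by gcongr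
    _ = 2 ^ 198 * m ^ 107 * m ^ 693 := by rw [mul_assoc, ← pow_mul, ← pow_add]
    _ ≤ 2 ^ 198 * (16 * q ^ 4) ^ 107 * m ^ 693 := by gcongr
    _ = 2 ^ 626 * q ^ 428 * m ^ 693 := by
        rw [mul_pow, ← pow_mul, show (16 : ℕ) = 2 ^ 4 by norm_num, ← pow_mul, ← mul_assoc,
          ← pow_add]
    _ ≤ q ^ 67 * q ^ 428 * m ^ 693 := by gcongr
    _ = (m ^ 7 * q ^ 5) ^ 99 := by
        rw [mul_pow, ← pow_mul, ← pow_mul, ← pow_add, mul_comm]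

lemma le_mul_of_two_mul_succ_mul_pow_le {n m q : ℕ} (hq : 0 < q)
    (h : 2 * (n + 1) * n ^ 7 ≤ m ^ 7 * q ^ 5) (hmn : m ≤ n) : n ≤ m * q := by
  by_contra! hlt
  rcases Nat.eq_zero_or_pos m with rfl | hm
  · have : 0 < 2 * (n + 1) * n ^ 7 := by
      have : 0 < n := by simpa using hlt
      positivity
    simp at h
    omega
  have h1 : (m * q) ^ 7 < n ^ 7 := Nat.pow_lt_pow_left hlt (by norm_num)
  have h2 : m ^ 7 * q ^ 5 ≤ (m * q) ^ 7 := by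
    rw [mul_pow]
    gcongr
    norm_num
  have h3 : n ^ 7 ≤ 2 * (n + 1) * n ^ 7 := Nat.le_mul_of_pos_left _ (by positivity)
  omega

lemma le_two_mul_of_pow_le {n m : ℕ} (h : n ^ 99 ≤ m ^ 100) (hm : m < 2 ^ 40) : n ≤ 2 * m := by
  rw [← Nat.pow_le_pow_iff_left (n := 99) (by norm_num)]
  calc n ^ 99 ≤ m ^ 99 * m := by rwa [← pow_succ]
    _ ≤ m ^ 99 * 2 ^ 99 := by
        gcongr
        exact hm.le.trans (Nat.pow_le_pow_right (by norm_num) (by norm_num))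
    _ = (2 * m) ^ 99 := by rw [mul_pow, mul_comm]

lemma exists_fourth_root (m : ℕ) : ∃ q : ℕ, q ^ 4 ≤ m ∧ m < (q + 1) ^ 4 := by
  refine ⟨Nat.sqrt (Nat.sqrt m), ?_, ?_⟩
  · calc _ = (Nat.sqrt (Nat.sqrt m) ^ 2) ^ 2 := by ring
      _ ≤ Nat.sqrt m ^ 2 := by gcongr; exact Nat.sqrt_le' _
      _ ≤ m := Nat.sqrt_le' _
  · have h1 := Nat.lt_succ_sqrt' m
    have h2 := Nat.lt_succ_sqrt' (Nat.sqrt m)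
    calc m < (Nat.sqrt m + 1) ^ 2 := h1
      _ ≤ ((Nat.sqrt (Nat.sqrt m) + 1) ^ 2) ^ 2 := by gcongr; exact h2
      _ = _ := by ring

/-- If a bounded quantity is small on `[T, L - T]`, so is its sum over `range L`. -/
lemma sum_range_le_of_middle {φ : ℕ → ℝ} {L T : ℕ} {a b : ℝ} (ha : 0 ≤ a) (hb : 0 ≤ b)
    (h : ∀ i, φ i ≤ a) (hmid : ∀ i, T ≤ i → i + T + 1 ≤ L → φ i ≤ b) :
    ∑ i ∈ Finset.range L, φ i ≤ L * b + 2 * T * a := by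
  have h1 : ∀ i ∈ Finset.range L, φ i ≤ b + ((if i ∈ Finset.range T then a else 0) +
      (if i ∈ Finset.Ico (L - T) L then a else 0)) := by
    intro i hi
    rw [Finset.mem_range] at hi
    by_cases h1 : i ∈ Finset.range T
    · rw [if_pos h1]
      split_ifs <;> linarith [h i]
    · by_cases h2 : i ∈ Finset.Ico (L - T) L
      · rw [if_neg h1, if_pos h2]
        linarith [h i]
      · rw [if_neg h1, if_neg h2]
        simp only [Finset.mem_range, Finset.mem_Ico] at h1 h2
        have := hmid i (by omega) (by omega)
        linarith
  refine (Finset.sum_le_sum h1).trans ?_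
  rw [Finset.sum_add_distrib, Finset.sum_add_distrib, Finset.sum_ite_mem, Finset.sum_ite_mem]
  simp only [Finset.sum_const, Finset.card_range, nsmul_eq_mul]
  have h2 : (((Finset.range L ∩ Finset.range T).card : ℕ) : ℝ) ≤ T := by
    exact_mod_cast (Finset.card_le_card Finset.inter_subset_right).trans (by simp)
  have h3 : (((Finset.range L ∩ Finset.Ico (L - T) L).card : ℕ) : ℝ) ≤ T := by
    exact_mod_cast (Finset.card_le_card Finset.inter_subset_right).trans (by rw [Nat.card_Ico]; omega)
  nlinarith [mul_le_mul_of_nonneg_right h2 ha, mul_le_mul_of_nonneg_right h3 ha]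

lemma bitAvg_ite_eq_bitProb {ι : Type*} [Fintype ι] [DecidableEq ι] (p : (ι → Bool) → Prop)
    [DecidablePred p] : bitAvg (fun e => if p e then (1 : ℝ) else 0) = bitProb {e | p e} := by
  refine congrArg bitAvg (funext fun e => ?_)
  simp [Set.indicator_apply]

lemma bitAvg_zeros_le_sum {n m : ℕ} (hmn : m ≤ n) {ℓ : ℝ} {L : ℕ} (hℓ : 0 < ℓ)
    (hL : π < L * ℓ) :
    bitAvg (fun e => (zeros (F n m e) (Set.Icc 0 (2 * π)) : ℝ)) ≤
      2 * (6 * ∑ i ∈ Finset.range L,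
          bitProb {e | HasZeros (F n m e) (Set.Icc (i * ℓ) (i * ℓ + ℓ)) 1} +
        n * ∑ i ∈ Finset.range L,
          bitProb {e | HasZeros (F n m e) (Set.Icc (i * ℓ) (i * ℓ + ℓ)) 7}) := by
  classical
  have h : ∀ e : Fin (m + 1) → Bool, (zeros (F n m e) (Set.Icc 0 (2 * π)) : ℝ) ≤
      2 * ∑ i ∈ Finset.range L,
        (6 * (if HasZeros (F n m e) (Set.Icc (i * ℓ) (i * ℓ + ℓ)) 1 then (1 : ℝ) else 0) +
          n * (if HasZeros (F n m e) (Set.Icc (i * ℓ) (i * ℓ + ℓ)) 7 then (1 : ℝ) else 0)) := by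
    intro e
    have h1 : (zeros (F n m e) (Set.Icc 0 (2 * π)) : ℝ) ≤
        2 * (zeros (F n m e) (Set.Icc 0 π) : ℝ) := by
      exact_mod_cast zeros_F_two_pi_le n m e
    refine h1.trans ?_
    gcongr
    convert zeros_F_le_sum hmn e hℓ hL
  refine (bitAvg_mono h).trans (le_of_eq ?_)
  rw [bitAvg_const_mul, bitAvg_sum]
  simp only [bitAvg_add, bitAvg_const_mul, bitAvg_ite_eq_bitProb]
  rw [Finset.sum_add_distrib, ← Finset.mul_sum, ← Finset.mul_sum]

lemma bitAvg_zeros_le {n m q : ℕ} (hm : 0 < m) (hmn : m ≤ n) (hq : 3 ≤ q) (hqm : q ^ 4 ≤ m)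
    (hmq : m ≤ 16 * q ^ 4) (hnq : n ≤ m * q) (hbig : 2 * (n + 1) * n ^ 7 ≤ m ^ 7 * q ^ 5) :
    bitAvg (fun e => (zeros (F n m e) (Set.Icc 0 (2 * π)) : ℝ)) ≤ 10 ^ 15 * m := by
  have hm0 : (0 : ℝ) < m := by exact_mod_cast hm
  have hm1 : (1 : ℝ) ≤ m := by exact_mod_cast hm
  have hq3 : (3 : ℝ) ≤ q := by exact_mod_cast hq
  have hq0 : (0 : ℝ) < q := by linarith
  have hq1 : (1 : ℝ) ≤ q := by linarith
  have hqm' : (q : ℝ) ^ 4 ≤ m := by exact_mod_cast hqm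
  have hmq' : (m : ℝ) ≤ 16 * (q : ℝ) ^ 4 := by exact_mod_cast hmq
  have hnq' : (n : ℝ) ≤ m * q := by exact_mod_cast hnq
  have hbig' : 2 * ((n : ℝ) + 1) * (n : ℝ) ^ 7 ≤ (m : ℝ) ^ 7 * (q : ℝ) ^ 5 := by
    exact_mod_cast hbig
  set L : ℕ := ⌊π * (m * q)⌋₊ + 1 with hL
  have hmq0 : (0 : ℝ) < m * q := by positivity
  have hLgt : π * (m * q) < L := by
    rw [hL]
    exact_mod_cast Nat.lt_floor_add_one _
  have hLle : (L : ℝ) ≤ π * (m * q) + 1 := by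
    rw [hL]
    push_cast
    linarith [Nat.floor_le (show 0 ≤ π * ((m : ℝ) * q) by positivity)]
  have hL5 : (L : ℝ) ≤ 5 * (m * q) := by
    nlinarith [Real.pi_lt_d2, one_le_mul_of_one_le_of_one_le hm1 hq1]
  have hsum := bitAvg_zeros_le_sum hmn (ℓ := 1 / (m * q)) (L := L) (by positivity) (by
    rw [mul_one_div, lt_div_iff₀ hmq0]
    exact hLgt)
  have hsin : ∀ {i T : ℕ}, T ≤ i → i + T + 1 ≤ L →
      5 / 8 * (T / (m * q)) ≤ |Real.sin (i * (1 / (m * q)))| := by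
    intro i T h1 h2
    refine (mul_le_sin_of_mem (by positivity) ?_ ?_).trans (le_abs_self _)
    · rw [mul_one_div]
      gcongr
    · rw [mul_one_div, le_sub_iff_add_le, ← add_div, div_le_iff₀ hmq0]
      have : ((i + T + 1 : ℕ) : ℝ) ≤ L := by exact_mod_cast h2
      push_cast at this
      linarith
  have hone := sum_range_le_of_middle (L := L) (T := m) (a := 1) (b := 175200 / q)
    (φ := fun i => bitProb {e | HasZeros (F n m e)
      (Set.Icc (i * (1 / (m * q))) (i * (1 / (m * q)) + 1 / (m * q))) 1})
    zero_le_one (by positivity) (fun i => bitProb_le_one _) (fun i h1 h2 =>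
      bitProb_hasZeros_one_le hm hmn hq3 hqm' hmq' hnq' hbig' (by
        refine le_trans ?_ (hsin h1 h2)
        field_simp
        norm_num))
  have hseven := sum_range_le_of_middle (L := L) (T := 1300 * q) (a := 1600 / q ^ 2)
    (b := 4 * 300 ^ 3 * 23 ^ 3 / q ^ 6)
    (φ := fun i => bitProb {e | HasZeros (F n m e)
      (Set.Icc (i * (1 / (m * q))) (i * (1 / (m * q)) + 1 / (m * q))) 7})
    (by positivity) (by positivity)
    (fun i => bitProb_hasZeros_seven_le hm hmn hq1 hqm' hbig' _) (fun i h1 h2 =>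
      bitProb_hasZeros_seven_le_of_sin hm hmn hq1 hqm' hbig' (by
        calc (768 : ℝ) ≤ m * (5 / 8 * ((1300 * q : ℕ) / (m * q))) := by
              push_cast
              field_simp
              norm_num
          _ ≤ _ := by
              gcongr
              exact hsin h1 h2))
  have hone' : (L : ℝ) * (175200 / q) + 2 * m * 1 ≤ 876002 * m := by
    calc (L : ℝ) * (175200 / q) + 2 * m * 1
        ≤ 5 * (m * q) * (175200 / q) + 2 * m * 1 := by gcongr
      _ = 876002 * m := by field_simp; norm_num
  have hseven' : (n : ℝ) * ((L : ℝ) * (4 * 300 ^ 3 * 23 ^ 3 / (q : ℝ) ^ 6) +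
      2 * ((1300 * q : ℕ) : ℝ) * (1600 / (q : ℝ) ^ 2)) ≤ 110000000000000 * m := by
    calc (n : ℝ) * ((L : ℝ) * (4 * 300 ^ 3 * 23 ^ 3 / (q : ℝ) ^ 6) +
          2 * ((1300 * q : ℕ) : ℝ) * (1600 / (q : ℝ) ^ 2))
        ≤ (m : ℝ) * q * (5 * (m * q) * (4 * 300 ^ 3 * 23 ^ 3 / (q : ℝ) ^ 6) +
          2 * ((1300 * q : ℕ) : ℝ) * (1600 / (q : ℝ) ^ 2)) := by gcongr
      _ = (20 * 300 ^ 3 * 23 ^ 3 * ((m : ℝ) / (q : ℝ) ^ 4) + 4160000) * m := by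
          push_cast
          field_simp
          ring
      _ ≤ (20 * 300 ^ 3 * 23 ^ 3 * 16 + 4160000) * m := by
          gcongr
          rw [div_le_iff₀ (by positivity)]
          exact hmq'
      _ ≤ 110000000000000 * m := by
          gcongr
          norm_num
  have hseven'' := (mul_le_mul_of_nonneg_left hseven n.cast_nonneg).trans hseven'
  have hone'' := hone.trans hone'
  linarith

end Expectation

/-- There is an absolute constant `C > 0` such that for all `n` and all `m` with
`n^{0.99} ≤ m ≤ n`: if `f ~ F_{n,m}` then `E Z(f) ≤ C m`, where the expectation is the
average over all `2^(m+1)` outcomes of the Bernoulli variables. -/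
theorem stmt15 :
    ∃ C : ℝ, 0 < C ∧ ∀ n m : ℕ, (n : ℝ) ^ (0.99 : ℝ) ≤ (m : ℝ) → m ≤ n →
      (∑ e : Fin (m + 1) → Bool, (zeros (F n m e) (Set.Icc 0 (2 * π)) : ℝ)) / 2 ^ (m + 1) ≤
        C * m := by
  refine ⟨10 ^ 15, by norm_num, fun n m hnm hmn => ?_⟩
  have hpow := pow_le_pow_of_rpow_le hnm
  have hE : (∑ e : Fin (m + 1) → Bool, (zeros (F n m e) (Set.Icc 0 (2 * π)) : ℝ)) / 2 ^ (m + 1) =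
      bitAvg (fun e => (zeros (F n m e) (Set.Icc 0 (2 * π)) : ℝ)) := by
    rw [bitAvg, Fintype.card_fin]
  rw [hE]
  obtain ⟨q, hqm, hmq⟩ := exists_fourth_root m
  rcases lt_or_ge q 1024 with hq | hq
  · have hm : m < 2 ^ 40 := by
      calc m < (q + 1) ^ 4 := hmq
        _ ≤ 1024 ^ 4 := Nat.pow_le_pow_left hq _
        _ = 2 ^ 40 := by norm_num
    have hn := le_two_mul_of_pow_le hpow hm
    rw [← bitAvg_const (ι := Fin (m + 1)) (10 ^ 15 * (m : ℝ))]
    refine bitAvg_mono fun e => ?_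
    have h1 : zeros (F n m e) (Set.Icc 0 (2 * π)) ≤ 10 ^ 15 * m := by
      have h2 := zeros_F_two_pi_le n m e
      have h3 := zeros_F_Icc_pi_le hmn e
      omega
    exact_mod_cast h1
  · have hm : 0 < m := lt_of_lt_of_le (by positivity) hqm
    have hmq' : m ≤ 16 * q ^ 4 := by
      calc m ≤ (q + 1) ^ 4 := hmq.le
        _ ≤ (2 * q) ^ 4 := Nat.pow_le_pow_left (by omega) _
        _ = 16 * q ^ 4 := by ring
    have hbig := two_mul_succ_mul_pow_le (hm.trans_le hmn) hpow hmq' hq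
    exact bitAvg_zeros_le hm hmn (by omega) hqm hmq'
      (le_mul_of_two_mul_succ_mul_pow_le (by omega) hbig hmn) hbig
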